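/- arXiv:2601.16450 — 2 statements merged into one kernel-verified Lean document; each statement's English description precedes it below -/
import Mathlib

section
/- Let d_in, d_out, n ∈ ℕ with n ≤ 6·2^p − 2. Then for every permutation-equivariant function f* : 𝔽^{d_in×n} → 𝔽^{d_out×n}, there exists a floating-point transformer f : 𝔽^{d_in×n} → 𝔽^{d_out×n} such that f(X) = f*(X) for all X ∈ 𝔽^{d_in×n}. -/
open scoped Classical

namespace FPT

noncomputable section

/-- Minimal exponent `𝔢_min = -2^(q-1) + 2`. -/
def emin (q : ℕ) : ℤ := -(2 ^ (q - 1) : ℤ) + 2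

/-- Maximal exponent `𝔢_max = 2^(q-1) - 1`. -/
def emax (q : ℕ) : ℤ := (2 ^ (q - 1) : ℤ) - 1

/-- The set of finite floating-point numbers with `p` mantissa bits and exponent bits `q`:
normal numbers `±(1.m₁⋯m_p)·2^e = m·2^(e-p)` with `2^p ≤ |m| ≤ 2^(p+1)-1` and
`emin ≤ e ≤ emax`, together with subnormal numbers `±(0.m₁⋯m_p)·2^emin = m·2^(emin-p)`
with `|m| ≤ 2^p - 1`. -/
def Fset (p q : ℕ) : Set ℝ :=
  {x | ∃ m e : ℤ, |m| ≤ 2 ^ (p + 1) - 1 ∧ emin q ≤ e ∧ e ≤ emax q ∧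
      ((2 : ℤ) ^ p ≤ |m| ∨ e = emin q) ∧ x = (m : ℝ) * (2 : ℝ) ^ (e - (p : ℤ))}

/-- The largest positive float `Ω = (2 - 2^(-p))·2^emax`. -/
def Omega (p q : ℕ) : ℝ := (2 - (2 : ℝ) ^ (-(p : ℤ))) * (2 : ℝ) ^ (emax q)

/-- Overflow threshold `Ω + 2^(emax - p - 1)`. -/
def thr (p q : ℕ) : ℝ := Omega p q + (2 : ℝ) ^ (emax q - (p : ℤ) - 1)

/-- `y` is a float whose last mantissa bit `m_p` is zero, i.e. `y = m·2^(e-p)` with `m` even. -/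
def EvenMantissa (p q : ℕ) (y : ℝ) : Prop :=
  ∃ m e : ℤ, |m| ≤ 2 ^ (p + 1) - 1 ∧ emin q ≤ e ∧ e ≤ emax q ∧
    ((2 : ℤ) ^ p ≤ |m| ∨ e = emin q) ∧ y = (m : ℝ) * (2 : ℝ) ^ (e - (p : ℤ)) ∧ 2 ∣ m

/-- `RoundsTo p q x y` : `y` is the rounding of `x` to the nearest float, ties to even. -/
def RoundsTo (p q : ℕ) (x y : ℝ) : Prop :=
  y ∈ Fset p q ∧ (∀ z ∈ Fset p q, |x - y| ≤ |x - z|) ∧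
    ((∀ z ∈ Fset p q, |x - z| = |x - y| → z = y) ∨ EvenMantissa p q y)

/-- Extended floats `𝔽̄ = 𝔽 ∪ {-∞, +∞, NaN}` (the payload of `fin` is meant to lie in `Fset`). -/
inductive EF where
  | fin : ℝ → EF
  | pinf : EF
  | ninf : EF
  | nan : EF

/-- Rounding `⌊·⌉ : ℝ → 𝔽̄`. -/
def rnd (p q : ℕ) (x : ℝ) : EF :=
  if thr p q ≤ x then .pinf
  else if x ≤ -thr p q then .ninf
  else .fin (Classical.epsilon (RoundsTo p q x))

/-- Floating-point addition `⊕`. -/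
def fadd (p q : ℕ) : EF → EF → EF
  | .nan, _ => .nan
  | _, .nan => .nan
  | .fin x, .fin y => rnd p q (x + y)
  | .fin _, .pinf => .pinf
  | .fin _, .ninf => .ninf
  | .pinf, .fin _ => .pinf
  | .ninf, .fin _ => .ninf
  | .pinf, .pinf => .pinf
  | .ninf, .ninf => .ninf
  | .pinf, .ninf => .nan
  | .ninf, .pinf => .nan

/-- Floating-point multiplication `⊗`. -/
def fmul (p q : ℕ) : EF → EF → EF
  | .nan, _ => .nan
  | _, .nan => .nan
  | .fin x, .fin y => rnd p q (x * y)
  | .fin x, .pinf => if 0 < x then .pinf else if x < 0 then .ninf else .nan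
  | .fin x, .ninf => if 0 < x then .ninf else if x < 0 then .pinf else .nan
  | .pinf, .fin y => if 0 < y then .pinf else if y < 0 then .ninf else .nan
  | .ninf, .fin y => if 0 < y then .ninf else if y < 0 then .pinf else .nan
  | .pinf, .pinf => .pinf
  | .ninf, .ninf => .pinf
  | .pinf, .ninf => .ninf
  | .ninf, .pinf => .ninf

/-- Floating-point subtraction `x ⊖ y = x ⊕ ((-1) ⊗ y)`. -/
def fsub (p q : ℕ) (x y : EF) : EF := fadd p q x (fmul p q (.fin (-1)) y)

/-- Floating-point division (defined for `0 ≤ x ≤ y < ∞`, `y > 0`; NaN propagates). -/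
def fdiv (p q : ℕ) : EF → EF → EF
  | _, .nan => .nan
  | .nan, _ => .nan
  | .fin x, .fin y => if 0 < y then rnd p q (x / y) else .nan
  | _, _ => .nan

/-- Correctly rounded exponential `⌊exp⌉`. -/
def fexp (p q : ℕ) : EF → EF
  | .fin x => rnd p q (Real.exp x)
  | .pinf => .pinf
  | .ninf => .fin 0
  | .nan => .nan

/-- Correctly rounded ReLU `ρ = ⌊ReLU⌉`. -/
def frelu (p q : ℕ) : EF → EF
  | .fin x => rnd p q (max x 0)
  | .pinf => .pinf
  | .ninf => .fin 0
  | .nan => .nan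

/-- Left-associative floating-point sum of a list (empty sum is `0`). -/
def fsuml (p q : ℕ) : List EF → EF
  | [] => .fin 0
  | x :: xs => xs.foldl (fadd p q) x

/-- Left-associative floating-point sum `⊕_{i=1}^{n} v i` over `Fin n`. -/
def fsum (p q : ℕ) {n : ℕ} (v : Fin n → EF) : EF := fsuml p q ((List.finRange n).map v)

/-- Matrices of extended floats. -/
abbrev Mat (a b : ℕ) := Fin a → Fin b → EF

/-- Entrywise floating-point matrix addition. -/
def madd (p q : ℕ) {a b : ℕ} (M N : Mat a b) : Mat a b := fun i j => fadd p q (M i j) (N i j)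

/-- Floating-point matrix multiplication with left-associative inner sums. -/
def mmul (p q : ℕ) {a b c : ℕ} (M : Mat a b) (N : Mat b c) : Mat a c :=
  fun i k => fsum p q (fun j => fmul p q (M i j) (N j k))

/-- Maximum of two extended floats (NaN-propagating). -/
def emax2 : EF → EF → EF
  | .nan, _ => .nan
  | _, .nan => .nan
  | .pinf, _ => .pinf
  | _, .pinf => .pinf
  | .fin x, .fin y => .fin (max x y)
  | .fin x, .ninf => .fin x
  | .ninf, y => y

/-- Maximum entry of a vector of extended floats. -/
def vmax {n : ℕ} (v : Fin n → EF) : EF := ((List.finRange n).map v).foldl emax2 .ninf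

/-- Floating-point softmax `σ(x)_i = ⌊exp⌉(x_i ⊖ x_*) ⊘ (⊕_j ⌊exp⌉(x_j ⊖ x_*))`. -/
def fsoftmax (p q : ℕ) {n : ℕ} (v : Fin n → EF) : Fin n → EF := fun i =>
  fdiv p q (fexp p q (fsub p q (v i) (vmax v)))
    (fsum p q (fun j => fexp p q (fsub p q (v j) (vmax v))))

/-- Column-wise application of the floating-point softmax. -/
def colSoftmax (p q : ℕ) {k n : ℕ} (A : Mat k n) : Mat k n :=
  fun i j => fsoftmax p q (fun i' => A i' j) i

/-- The extended float is a finite float in `𝔽`. -/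
def EF.IsF (p q : ℕ) : EF → Prop
  | .fin x => x ∈ Fset p q
  | _ => False

/-- The extended float is a well-formed element of `𝔽̄`. -/
def EF.Valid (p q : ℕ) : EF → Prop
  | .fin x => x ∈ Fset p q
  | _ => True

/-- The extended float is finite (not `±∞` or NaN). -/
def EF.Finite : EF → Prop
  | .fin _ => True
  | _ => False

/-- All entries of a vector are finite floats. -/
def VecFin (p q : ℕ) {a : ℕ} (v : Fin a → EF) : Prop := ∀ i, (v i).IsF p q

/-- All entries of a matrix are finite floats. -/
def MatFin (p q : ℕ) {a b : ℕ} (M : Mat a b) : Prop := ∀ i j, (M i j).IsF p q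

/-- Embed a real matrix as a matrix of extended floats. -/
def toEF {a b : ℕ} (M : Fin a → Fin b → ℝ) : Mat a b := fun i j => .fin (M i j)

/-- Parameters of one transformer block (attention layer followed by feed-forward layer)
with `h` heads, head dimension `m`, feed-forward width `r`, hidden dimension `d`. -/
structure Block (h m r d : ℕ) where
  WK : Fin h → Fin m → Fin d → ℝ
  WQ : Fin h → Fin m → Fin d → ℝ
  WV : Fin h → Fin m → Fin d → ℝ
  WO : Fin h → Fin d → Fin m → ℝ
  W1 : Fin r → Fin d → ℝ
  W2 : Fin d → Fin r → ℝ
  b1 : Fin r → ℝ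
  b2 : Fin d → ℝ

/-- All parameters of the block are floats. -/
def Block.Valid (p q : ℕ) {h m r d : ℕ} (B : Block h m r d) : Prop :=
  (∀ i a b, B.WK i a b ∈ Fset p q) ∧ (∀ i a b, B.WQ i a b ∈ Fset p q) ∧
    (∀ i a b, B.WV i a b ∈ Fset p q) ∧ (∀ i a b, B.WO i a b ∈ Fset p q) ∧
    (∀ a b, B.W1 a b ∈ Fset p q) ∧ (∀ a b, B.W2 a b ∈ Fset p q) ∧
    (∀ a, B.b1 a ∈ Fset p q) ∧ (∀ a, B.b2 a ∈ Fset p q)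

/-- The attention layer
`AT(X) = X ⊕ (⊕_i W_i^O ⊗ ((W_i^V ⊗ X) ⊗ σ((W_i^K ⊗ X)ᵀ ⊗ (W_i^Q ⊗ X))))`. -/
def attnApply (p q : ℕ) {h m r d : ℕ} (B : Block h m r d) {n : ℕ} (X : Mat d n) : Mat d n :=
  madd p q X (fun a b =>
    fsum p q (fun i =>
      (mmul p q (toEF (B.WO i))
        (mmul p q (mmul p q (toEF (B.WV i)) X)
          (colSoftmax p q
            (mmul p q (fun u v => mmul p q (toEF (B.WK i)) X v u)
              (mmul p q (toEF (B.WQ i)) X))))) a b))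

/-- The feed-forward layer `FF(X) = X ⊕ (W₂ ⊗ ρ(W₁ ⊗ X ⊕ b₁1ᵀ) ⊕ b₂1ᵀ)`. -/
def ffApply (p q : ℕ) {h m r d : ℕ} (B : Block h m r d) {n : ℕ} (X : Mat d n) : Mat d n :=
  madd p q X
    (madd p q
      (mmul p q (toEF B.W2)
        (fun i j => frelu p q
          ((madd p q (mmul p q (toEF B.W1) X) (fun a _ => .fin (B.b1 a))) i j)))
      (fun a _ => .fin (B.b2 a)))

/-- One transformer block: `FF ∘ AT`. -/
def Block.apply (p q : ℕ) {h m r d n : ℕ} (B : Block h m r d) (X : Mat d n) : Mat d n :=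
  ffApply p q B (attnApply p q B X)

/-- Composition of a list of transformer blocks (applied from left to right). -/
def blocksApply (p q : ℕ) {h m r d n : ℕ} (L : List (Block h m r d)) (X : Mat d n) : Mat d n :=
  L.foldl (fun Y B => Block.apply p q B Y) X

/-- `f` is a floating-point transformer:
`f(X) = W_out ⊗ g(W_in ⊗ X ⊕ b_in 1ᵀ) ⊕ b_out 1ᵀ` with `g` a nonempty composition of
transformer blocks and all parameters finite floats. -/
def IsTransformer (p q din dout n : ℕ) (f : Mat din n → Mat dout n) : Prop :=
  ∃ (h m r d : ℕ) (L : List (Block h m r d)) (Win : Fin d → Fin din → ℝ) (bin : Fin d → ℝ)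
      (Wout : Fin dout → Fin d → ℝ) (bout : Fin dout → ℝ),
    0 < h ∧ 0 < m ∧ 0 < r ∧ 0 < d ∧ L ≠ [] ∧ (∀ B ∈ L, B.Valid p q) ∧
      (∀ i j, Win i j ∈ Fset p q) ∧ (∀ i, bin i ∈ Fset p q) ∧
      (∀ i j, Wout i j ∈ Fset p q) ∧ (∀ i, bout i ∈ Fset p q) ∧
      ∀ X : Mat din n,
        f X = madd p q
          (mmul p q (toEF Wout)
            (blocksApply p q L
              (madd p q (mmul p q (toEF Win) X) (fun i _ => .fin (bin i)))))
          (fun i _ => .fin (bout i))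

/-- Column permutation: column `j` of `permCols π X` is column `π j` of `X`. -/
def permCols {a n : ℕ} (π : Equiv.Perm (Fin n)) (X : Mat a n) : Mat a n := fun i j => X i (π j)

/-- The transposition `π_{(1,2)}^n` of the first two coordinates. -/
def swap12 (n : ℕ) (hn : 2 ≤ n) : Equiv.Perm (Fin n) :=
  Equiv.swap ⟨0, by omega⟩ ⟨1, by omega⟩

/-- The columns of `X` are pairwise distinct. -/
def DistinctCols {a n : ℕ} (X : Mat a n) : Prop :=
  ∀ j k : Fin n, j ≠ k → ∃ i, X i j ≠ X i k

/-- `(α,β)`-similarity (with 1-based column index `i = j+1`). -/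
def Similar {a n : ℕ} (α β : ℕ) (X Y : Mat a n) : Prop :=
  ∃ z1 z2 : Fin a → EF,
    (∀ j : Fin n, (j : ℕ) + 1 ≤ α → ∀ i, X i j = z1 i) ∧
    (∀ j : Fin n, α < (j : ℕ) + 1 → (j : ℕ) + 1 ≤ β → ∀ i, X i j = z2 i) ∧
    (∀ j : Fin n, (j : ℕ) + 1 < α → ∀ i, Y i j = z1 i) ∧
    (∀ j : Fin n, α ≤ (j : ℕ) + 1 → (j : ℕ) + 1 ≤ β → ∀ i, Y i j = z2 i) ∧
    (∀ j : Fin n, β < (j : ℕ) + 1 → ∀ i, X i j = Y i j)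

/-- The smallest float strictly greater than `x` (junk value if none exists). -/
def succF (p q : ℕ) (x : ℝ) : ℝ := sInf {y | y ∈ Fset p q ∧ x < y}

/-- Successor on extended floats: the smallest element of `𝔽 ∪ {+∞}` strictly above. -/
def succEF (p q : ℕ) : EF → EF
  | .fin r => if ∃ y ∈ Fset p q, r < y then .fin (succF p q r) else .pinf
  | e => e

/-- Floating-point affine transformation `φ(x) = W ⊗ x ⊕ b`. -/
def affApply (p q : ℕ) {a b : ℕ} (W : Fin b → Fin a → ℝ) (c : ℝ) (v : Fin a → EF) :
    Fin b → EF :=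
  fun i => fadd p q (fsum p q (fun j => fmul p q (.fin (W i j)) (v j))) (.fin c)

/-- All intermediate values of `φ(x) = W ⊗ x ⊕ b` on input `v`, including every
left-associative partial sum of the matrix–vector product, are finite. -/
def AffIntermFin (p q : ℕ) {a b : ℕ} (W : Fin b → Fin a → ℝ) (c : ℝ) (v : Fin a → EF) : Prop :=
  ∀ i : Fin b,
    (∀ k : ℕ,
      (fsuml p q (((List.finRange a).take k).map
        (fun j => fmul p q (.fin (W i j)) (v j)))).Finite) ∧
    (affApply p q W c v i).Finite

end
end FPT



namespace FPT

section Arithmetic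

variable {p q : ℕ}

lemma emin_eq (q : ℕ) : emin q = 1 - emax q := by
  unfold emin emax; ring

lemma zpow_two_pos (k : ℤ) : (0 : ℝ) < (2 : ℝ) ^ k := by positivity

lemma zpow_two_le {a b : ℤ} (h : a ≤ b) : (2 : ℝ) ^ a ≤ (2 : ℝ) ^ b :=
  zpow_le_zpow_right₀ (by norm_num) h

lemma zpow_two_add (a b : ℤ) : (2 : ℝ) ^ (a + b) = (2 : ℝ) ^ a * (2 : ℝ) ^ b :=
  zpow_add₀ (by norm_num) a b

lemma mul_zpow_eq_natMul (m : ℤ) {k j : ℤ} (h : j ≤ k) :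
    (m : ℝ) * (2 : ℝ) ^ k = ((m * 2 ^ (k - j).toNat : ℤ) : ℝ) * (2 : ℝ) ^ j := by
  have : (2 : ℝ) ^ k = (2 : ℝ) ^ (k - j).toNat * (2 : ℝ) ^ j := by
    rw [← zpow_natCast, ← zpow_two_add, Int.toNat_of_nonneg (by omega)]
    congr 1; ring
  push_cast
  rw [this]; ring

lemma mem_Fset_of_le {m e : ℤ} (hm : |m| ≤ 2 ^ (p + 1) - 1) (h1 : emin q ≤ e)
    (h2 : e ≤ emax q) : (m : ℝ) * (2 : ℝ) ^ (e - (p : ℤ)) ∈ Fset p q := by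
  obtain ⟨k, hk⟩ : ∃ k : ℕ, e = emin q + k := ⟨(e - emin q).toNat, by omega⟩
  induction k generalizing m e with
  | zero => exact ⟨m, e, hm, h1, h2, Or.inr (by simpa using hk), rfl⟩
  | succ k ih =>
    by_cases hb : (2 : ℤ) ^ p ≤ |m|
    · exact ⟨m, e, hm, h1, h2, Or.inl hb, rfl⟩
    · have h : |2 * m| ≤ 2 ^ (p + 1) - 1 := by
        rw [abs_mul, pow_succ]; simp only [abs_two]; omega
      have := ih (m := 2 * m) (e := e - 1) h (by push_cast at hk; omega) (by omega)
        (by push_cast at hk; omega)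
      convert this using 1
      rw [show e - (p : ℤ) = (e - 1 - p) + 1 by ring, zpow_two_add]
      push_cast; ring

/-- Integer multiples `m * 2 ^ k` of a power of two with `|m| ≤ 2 ^ (p + 1)` are floats. -/
lemma mul_zpow_mem {m k : ℤ} (hm : |m| ≤ 2 ^ (p + 1)) (h1 : emin q - p ≤ k)
    (h2 : k + p + 1 ≤ emax q) : (m : ℝ) * (2 : ℝ) ^ k ∈ Fset p q := by
  rcases hm.lt_or_eq with h | h
  · have := mem_Fset_of_le (p := p) (q := q) (m := m) (e := k + p) (by omega) (by omega) (by omega)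
    simpa using this
  · have hev : ∃ m', m = 2 * m' ∧ |m'| = 2 ^ p := by
      have h2 : |m| = 2 * 2 ^ p := by rw [h, pow_succ]; ring
      rcases abs_choice m with hc | hc
      · exact ⟨2 ^ p, by omega, by simp⟩
      · exact ⟨-2 ^ p, by omega, by simp⟩
    obtain ⟨m', rfl, hm'⟩ := hev
    have hpos : (1 : ℤ) ≤ 2 ^ p := one_le_pow₀ (by norm_num)
    have := mem_Fset_of_le (p := p) (q := q) (m := m') (e := k + p + 1)
      (by rw [pow_succ]; omega) (by omega) (by omega)
    convert this using 1
    rw [show k + (p : ℤ) + 1 - p = k + 1 by ring, zpow_two_add]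
    push_cast; ring

lemma zpow_mem {k : ℤ} (hE : emin q ≤ emax q) (h1 : emin q - p ≤ k) (h2 : k ≤ emax q) :
    (2 : ℝ) ^ k ∈ Fset p q := by
  have hp1 : (1 : ℤ) ≤ 2 ^ p := one_le_pow₀ (by norm_num)
  by_cases h : k + p ≤ emax q
  · have := mem_Fset_of_le (p := p) (q := q) (m := 1) (e := k + p)
      (by rw [pow_succ]; simp; omega) (by omega) (by omega)
    simpa using this
  · by_cases h3 : emin q ≤ k
    · have := mem_Fset_of_le (p := p) (q := q) (m := 2 ^ p) (e := k)
        (by rw [pow_succ]; simp) (by omega) (by omega)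
      convert this using 1
      push_cast
      rw [← zpow_natCast, ← zpow_two_add]; congr 1; ring
    · have := mem_Fset_of_le (p := p) (q := q) (m := 2 ^ (k + p - emax q).toNat) (e := emax q)
        (by
          have h4 : (2 : ℤ) ^ (k + p - emax q).toNat ≤ 2 ^ p :=
            pow_le_pow_right₀ (by norm_num) (by omega)
          rw [pow_succ, abs_of_nonneg (by positivity)]; omega) (by omega) (by omega)
      convert this using 1
      push_cast
      rw [← zpow_natCast, ← zpow_two_add]; congr 1; omega

lemma neg_mem_Fset {x : ℝ} (hx : x ∈ Fset p q) : -x ∈ Fset p q := by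
  obtain ⟨m, e, h1, h2, h3, h4, rfl⟩ := hx
  exact ⟨-m, e, by simpa using h1, h2, h3, by simpa using h4, by push_cast; ring⟩

lemma Fset_multiple {x : ℝ} (hx : x ∈ Fset p q) :
    ∃ m : ℤ, x = m * (2 : ℝ) ^ (emin q - p) := by
  obtain ⟨m, e, h1, h2, h3, h4, rfl⟩ := hx
  exact ⟨_, mul_zpow_eq_natMul m (by omega)⟩

/-- Floats of absolute value at least `2 ^ (k + p)` are integer multiples of `2 ^ k`. -/
lemma Fset_multiple_of_le {x : ℝ} {k : ℤ} (hx : x ∈ Fset p q) (hk : (2 : ℝ) ^ (k + p) ≤ |x|) :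
    ∃ m : ℤ, x = m * (2 : ℝ) ^ k := by
  obtain ⟨m, e, h1, h2, h3, h4, rfl⟩ := hx
  refine ⟨_, mul_zpow_eq_natMul m ?_⟩
  by_contra hlt
  push Not at hlt
  rw [abs_mul, abs_of_pos (zpow_two_pos _)] at hk
  have hm : |(m : ℝ)| < (2 : ℝ) ^ ((p : ℤ) + 1) := by
    have : |m| < 2 ^ (p + 1) := by omega
    exact_mod_cast this
  have h5 := mul_lt_mul_of_pos_right hm (zpow_two_pos (e - p))
  rw [← zpow_two_add] at h5
  have h6 : (2 : ℝ) ^ ((p : ℤ) + 1 + (e - p)) ≤ (2 : ℝ) ^ (k + p) := zpow_two_le (by omega)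
  linarith

lemma Omega_eq : Omega p q = (2 ^ (p + 1) - 1) * (2 : ℝ) ^ (emax q - p) := by
  unfold Omega
  rw [sub_eq_add_neg (emax q), zpow_two_add, pow_succ, zpow_neg, zpow_natCast]
  have : (2 : ℝ) ^ p ≠ 0 := by positivity
  field_simp

lemma Omega_lt_thr : Omega p q < thr p q := by
  unfold thr
  linarith [zpow_two_pos (emax q - (p : ℤ) - 1)]

lemma zpow_emax_le_Omega : (2 : ℝ) ^ emax q ≤ Omega p q := by
  unfold Omega
  have h : (2 : ℝ) ^ (-(p : ℤ)) ≤ 1 := by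
    simpa using zpow_two_le (a := -(p : ℤ)) (b := 0) (by omega)
  nlinarith [zpow_two_pos (emax q)]

lemma abs_le_Omega {x : ℝ} (hx : x ∈ Fset p q) : |x| ≤ Omega p q := by
  obtain ⟨m, e, h1, h2, h3, h4, rfl⟩ := hx
  rw [Omega_eq, abs_mul, abs_of_pos (zpow_two_pos _)]
  have hm : |(m : ℝ)| ≤ 2 ^ (p + 1) - 1 := by exact_mod_cast h1
  exact mul_le_mul hm (zpow_two_le (by omega)) (zpow_two_pos _).le
    (le_trans (abs_nonneg _) hm)

lemma Fset_finite : (Fset p q).Finite := by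
  refine ((Set.finite_Icc (-(2 ^ (p + 1) - 1 : ℤ)) (2 ^ (p + 1) - 1)).prod
    (Set.finite_Icc (emin q) (emax q))).image
    (fun z : ℤ × ℤ => (z.1 : ℝ) * (2 : ℝ) ^ (z.2 - (p : ℤ))) |>.subset ?_
  rintro x ⟨m, e, h1, h2, h3, h4, rfl⟩
  exact ⟨(m, e), ⟨⟨by have := (abs_le.1 h1).1; simpa using this, (abs_le.1 h1).2⟩, h2, h3⟩, rfl⟩

lemma EvenMantissa.neg {x : ℝ} (hx : EvenMantissa p q x) : EvenMantissa p q (-x) := by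
  obtain ⟨m, e, h1, h2, h3, h4, rfl, h5⟩ := hx
  exact ⟨-m, e, by simpa using h1, h2, h3, by simpa using h4, by push_cast; ring, by simpa using h5⟩

/-- A float below another float has an even mantissa, or its successor in its own binade does. -/
lemma even_or_even_add {m e : ℤ} (hm : |m| ≤ 2 ^ (p + 1) - 1) (h1 : emin q ≤ e)
    (h2 : e ≤ emax q) (h3 : (2 : ℤ) ^ p ≤ |m| ∨ e = emin q) (hp : 1 ≤ p)
    (hlt : (m : ℝ) * (2 : ℝ) ^ (e - (p : ℤ)) < Omega p q) :
    EvenMantissa p q ((m : ℝ) * (2 : ℝ) ^ (e - (p : ℤ))) ∨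
      EvenMantissa p q (((m + 1 : ℤ) : ℝ) * (2 : ℝ) ^ (e - (p : ℤ))) := by
  by_cases hev : 2 ∣ m
  · exact Or.inl ⟨m, e, hm, h1, h2, h3, rfl, hev⟩
  right
  have hpp : (2 : ℤ) ∣ 2 ^ p := dvd_pow_self 2 (by omega)
  have hp1 : (2 : ℤ) ^ (p + 1) = 2 * 2 ^ p := by rw [pow_succ]; ring
  have hpos : (0 : ℤ) < 2 ^ p := by positivity
  by_cases hmax : m = 2 ^ (p + 1) - 1
  · have he : e < emax q := by
      rcases h2.lt_or_eq with h | h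
      · exact h
      · exfalso
        rw [Omega_eq, hmax, h] at hlt
        push_cast at hlt
        exact lt_irrefl _ hlt
    refine ⟨2 ^ p, e + 1, by rw [abs_of_pos hpos]; omega, by omega, by omega,
      Or.inl (le_abs_self _), ?_, hpp⟩
    rw [hmax, show e + 1 - (p : ℤ) = (e - p) + 1 by ring, zpow_two_add]
    push_cast
    rw [pow_succ]; ring
  · refine ⟨m + 1, e, ?_, h1, h2, ?_, rfl, by omega⟩
    · rw [abs_le] at hm ⊢; omega
    · rcases h3 with h3 | h3
      · left
        rcases abs_cases m with ⟨ha, _⟩ | ⟨ha, _⟩ <;> rcases abs_cases (m + 1) with ⟨hb, _⟩ | ⟨hb, _⟩ <;> omega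
      · exact Or.inr h3

lemma EvenMantissa.mem {x : ℝ} (hx : EvenMantissa p q x) : x ∈ Fset p q := by
  obtain ⟨m, e, h1, h2, h3, h4, h5, -⟩ := hx
  exact ⟨m, e, h1, h2, h3, h4, h5⟩

/-- Of two consecutive floats, one has an even mantissa. -/
lemma even_of_adjacent {y z : ℝ} (hp : 1 ≤ p) (hy : y ∈ Fset p q) (hz : z ∈ Fset p q)
    (hyz : y < z) (hadj : ∀ w ∈ Fset p q, w ≤ y ∨ z ≤ w) :
    EvenMantissa p q y ∨ EvenMantissa p q z := by
  have hy' := hy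
  have hz' := hz
  obtain ⟨m, e, h1, h2, h3, h4, hye⟩ := hy
  obtain ⟨m', e', h1', h2', h3', h4', hze⟩ := hz
  have hcommon : ∀ {a b j : ℤ} , (a : ℝ) * (2 : ℝ) ^ j < b * (2 : ℝ) ^ j →
      (a + 1 : ℝ) * (2 : ℝ) ^ j ≤ b * (2 : ℝ) ^ j := by
    intro a b j h
    have : (a : ℝ) < b := lt_of_mul_lt_mul_right h (zpow_two_pos j).le
    have : a + 1 ≤ b := by exact_mod_cast this
    exact mul_le_mul_of_nonneg_right (by exact_mod_cast this) (zpow_two_pos j).le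
  rcases le_total e e' with he | he
  · rcases even_or_even_add h1 h2 h3 h4 hp
      (hye ▸ lt_of_lt_of_le hyz (le_trans (le_abs_self _) (abs_le_Omega hz'))) with h | h
    · left; rwa [hye]
    · right
      have hs : z ≤ ((m + 1 : ℤ) : ℝ) * (2 : ℝ) ^ (e - (p : ℤ)) := by
        refine (hadj _ h.mem).resolve_left ?_
        rw [hye]; push_cast
        nlinarith [zpow_two_pos (e - (p : ℤ))]
      have hr := mul_zpow_eq_natMul m' (k := e' - p) (j := e - p) (by omega)
      have : (m + 1 : ℝ) * (2 : ℝ) ^ (e - (p : ℤ)) ≤ z := by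
        rw [hze, hr]
        apply hcommon
        rw [← hr, ← hze, ← hye]; exact hyz
      have hEq : z = ((m + 1 : ℤ) : ℝ) * (2 : ℝ) ^ (e - (p : ℤ)) := le_antisymm hs (by push_cast; exact this)
      rwa [hEq]
  · have hlt : ((-m' : ℤ) : ℝ) * (2 : ℝ) ^ (e' - (p : ℤ)) < Omega p q := by
      have := le_trans (neg_le_abs y) (abs_le_Omega hy')
      push_cast
      rw [neg_mul, ← hze]; linarith
    rcases even_or_even_add (m := -m') (by simpa using h1') h2' h3' (by simpa using h4') hp hlt with h | h
    · right
      have := h.neg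
      push_cast at this
      rw [neg_mul, neg_neg] at this
      rwa [hze]
    · left
      have h' := h.neg
      have hval : -(((-m' + 1 : ℤ) : ℝ) * (2 : ℝ) ^ (e' - (p : ℤ)))
          = z - (2 : ℝ) ^ (e' - (p : ℤ)) := by
        rw [hze]; push_cast; ring
      rw [hval] at h'
      have hs : z - (2 : ℝ) ^ (e' - (p : ℤ)) ≤ y := by
        refine (hadj _ h'.mem).resolve_right ?_
        have := zpow_two_pos (e' - (p : ℤ))
        linarith
      have hr := mul_zpow_eq_natMul m (k := e - p) (j := e' - p) (by omega)
      have hge : y + (2 : ℝ) ^ (e' - (p : ℤ)) ≤ z := by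
        have := hcommon (a := m * 2 ^ (e - p - (e' - p)).toNat) (b := m') (j := e' - p)
          (by rw [← hr, ← hze, ← hye]; exact hyz)
        rw [add_mul, one_mul, ← hr, ← hze, ← hye] at this
        exact this
      have hEq : y = z - (2 : ℝ) ^ (e' - (p : ℤ)) := le_antisymm (by linarith) hs
      rwa [hEq]

lemma zero_mem (hE : emin q ≤ emax q) : (0 : ℝ) ∈ Fset p q := by
  have := mem_Fset_of_le (p := p) (q := q) (m := 0) (e := emin q)
    (by simpa using one_le_pow₀ (M₀ := ℤ) (a := 2) (by norm_num)) le_rfl hE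
  simpa using this

lemma exists_roundsTo (hp : 1 ≤ p) (hE : emin q ≤ emax q) (x : ℝ) :
    ∃ y, RoundsTo p q x y := by
  obtain ⟨y, hy, hmin⟩ := Set.exists_min_image (Fset p q) (fun z => |x - z|) Fset_finite
    ⟨0, zero_mem hE⟩
  by_cases hu : ∀ z ∈ Fset p q, |x - z| = |x - y| → z = y
  · exact ⟨y, hy, hmin, Or.inl hu⟩
  push Not at hu
  obtain ⟨z, hz, hzy, hne⟩ := hu
  have hminz : ∀ w ∈ Fset p q, |x - z| ≤ |x - w| := fun w hw => hzy ▸ hmin w hw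
  have key : ∀ {a b : ℝ}, a ∈ Fset p q → b ∈ Fset p q → a < b → |x - a| = |x - b| →
      (∀ w ∈ Fset p q, |x - a| ≤ |x - w|) → EvenMantissa p q a ∨ EvenMantissa p q b := by
    intro a b ha hb hab heq hm
    refine even_of_adjacent hp ha hb hab ?_
    intro w hw
    by_contra hcon
    push Not at hcon
    have h1 := hm w hw
    have h2 := heq ▸ h1
    rcases abs_cases (x - a) with ⟨h3, _⟩ | ⟨h3, _⟩ <;>
      rcases abs_cases (x - b) with ⟨h4, _⟩ | ⟨h4, _⟩ <;>
      rcases abs_cases (x - w) with ⟨h5, _⟩ | ⟨h5, _⟩ <;> linarith [hcon.1, hcon.2]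
  have hev : EvenMantissa p q y ∨ EvenMantissa p q z := by
    rcases lt_or_gt_of_ne hne with h | h
    · exact (key hz hy h hzy hminz).symm
    · exact key hy hz h hzy.symm hmin
  rcases hev with h | h
  · exact ⟨y, hy, hmin, Or.inr h⟩
  · exact ⟨z, hz, hminz, Or.inr h⟩

end Arithmetic

end FPT


namespace FPT

section Rounding

variable {p q : ℕ}

/-- The standing assumption on the floating-point format. -/
def WideRange (p q : ℕ) : Prop := 2 ≤ p ∧ (p : ℤ) + 2 ≤ emax q

lemma WideRange.two_le (h : WideRange p q) : 2 ≤ p := h.1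

lemma WideRange.add_le (h : WideRange p q) : (p : ℤ) + 2 ≤ emax q := h.2

lemma WideRange.emin_le (h : WideRange p q) : emin q ≤ -p - 1 := by
  have := h.2
  rw [emin_eq]; omega

lemma WideRange.emin_le_emax (h : WideRange p q) : emin q ≤ emax q := by
  have := h.add_le
  have := h.emin_le
  omega

/-- The float nearest to a real number, ignoring overflow. -/
noncomputable def rv (p q : ℕ) (x : ℝ) : ℝ := Classical.epsilon (RoundsTo p q x)

lemma rv_spec (h : WideRange p q) (x : ℝ) : RoundsTo p q x (rv p q x) :=
  Classical.epsilon_spec (exists_roundsTo (by have := h.two_le; omega) h.emin_le_emax x)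

lemma rv_mem (h : WideRange p q) (x : ℝ) : rv p q x ∈ Fset p q := (rv_spec h x).1

lemma rv_le (h : WideRange p q) {x a : ℝ} (ha : a ∈ Fset p q) (hx : x ≤ a) : rv p q x ≤ a := by
  by_contra hlt
  push Not at hlt
  have := (rv_spec h x).2.1 a ha
  rw [abs_of_nonpos (by linarith), abs_of_nonpos (by linarith)] at this
  linarith

lemma le_rv (h : WideRange p q) {x a : ℝ} (ha : a ∈ Fset p q) (hx : a ≤ x) : a ≤ rv p q x := by
  by_contra hlt
  push Not at hlt
  have := (rv_spec h x).2.1 a ha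
  rw [abs_of_nonneg (by linarith), abs_of_nonneg (by linarith)] at this
  linarith

lemma rv_self (h : WideRange p q) {x : ℝ} (hx : x ∈ Fset p q) : rv p q x = x :=
  le_antisymm (rv_le h hx le_rfl) (le_rv h hx le_rfl)

lemma rnd_eq {x : ℝ} (hx : |x| ≤ Omega p q) : rnd p q x = .fin (rv p q x) := by
  have h1 := Omega_lt_thr (p := p) (q := q)
  have h2 := abs_le.1 hx
  unfold rnd rv
  rw [if_neg (by linarith), if_neg (by linarith)]

lemma rnd_self (h : WideRange p q) {x : ℝ} (hx : x ∈ Fset p q) : rnd p q x = .fin x := by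
  rw [rnd_eq (abs_le_Omega hx), rv_self h hx]

lemma rnd_valid (h : WideRange p q) (x : ℝ) : (rnd p q x).Valid p q := by
  unfold rnd
  split_ifs
  · trivial
  · trivial
  · exact rv_mem h x

/-- Rounding up to `a` or below if the excess over `a` is less than half the spacing at `a`. -/
lemma rv_le_of_excess (h : WideRange p q) {x a : ℝ} {k : ℤ} (ha : a ∈ Fset p q)
    (hk : (2 : ℝ) ^ (k + p) ≤ a) (hx : 2 * (x - a) < (2 : ℝ) ^ k) : rv p q x ≤ a := by
  by_contra hlt
  push Not at hlt
  have hpos := zpow_two_pos (k + p)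
  obtain ⟨m, hm⟩ := Fset_multiple_of_le ha (hk.trans (le_abs_self a))
  obtain ⟨m', hm'⟩ := Fset_multiple_of_le (rv_mem h x) ((hk.trans hlt.le).trans (le_abs_self _))
  have hmm : m + 1 ≤ m' := by
    have : (m : ℝ) < m' := by
      rw [hm, hm'] at hlt
      exact lt_of_mul_lt_mul_right hlt (zpow_two_pos k).le
    exact_mod_cast this
  have hge : a + (2 : ℝ) ^ k ≤ rv p q x := by
    rw [hm, hm']
    have : (m : ℝ) + 1 ≤ m' := by exact_mod_cast hmm
    nlinarith [zpow_two_pos k]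
  have h1 := (rv_spec h x).2.1 a ha
  rw [abs_of_nonpos (by linarith)] at h1
  rcases abs_cases (x - a) with ⟨h2, _⟩ | ⟨h2, _⟩ <;> linarith

/-- Adding more than half of the spacing strictly increases a float. -/
lemma lt_rv_add (h : WideRange p q) {x w : ℝ} {k : ℤ} (hx0 : 0 ≤ x)
    (hx : x < (2 : ℝ) ^ (k + p + 1)) (h1 : emin q - p ≤ k) (h2 : k + p + 1 ≤ emax q)
    (hw : (2 : ℝ) ^ k < 2 * w) : x < rv p q (x + w) := by
  by_contra hle
  push Not at hle
  have hpos := zpow_two_pos k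
  set m : ℤ := ⌊x / (2 : ℝ) ^ k⌋ with hm
  have hm0 : 0 ≤ m := Int.floor_nonneg.2 (by positivity)
  have hmlt : m < 2 ^ (p + 1) := by
    have h3 : (m : ℝ) ≤ x / (2 : ℝ) ^ k := Int.floor_le _
    have h4 : x / (2 : ℝ) ^ k < (2 : ℝ) ^ (p + 1) := by
      rw [div_lt_iff₀ hpos]
      calc x < (2 : ℝ) ^ (k + p + 1) := hx
        _ = _ := by
          rw [← zpow_natCast, ← zpow_two_add]; congr 1; push_cast; ring
    exact_mod_cast h3.trans_lt h4
  have hmem : ((m + 1 : ℤ) : ℝ) * (2 : ℝ) ^ k ∈ Fset p q :=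
    mul_zpow_mem (by rw [abs_of_nonneg (by omega)]; omega) h1 h2
  have hlow : x < ((m + 1 : ℤ) : ℝ) * (2 : ℝ) ^ k := by
    have := Int.lt_floor_add_one (x / (2 : ℝ) ^ k)
    rw [div_lt_iff₀ hpos] at this
    push_cast; exact this
  have hup : ((m + 1 : ℤ) : ℝ) * (2 : ℝ) ^ k ≤ x + (2 : ℝ) ^ k := by
    have := Int.floor_le (x / (2 : ℝ) ^ k)
    rw [le_div_iff₀ hpos] at this
    push_cast; linarith
  have h3 := (rv_spec h (x + w)).2.1 _ hmem
  rw [abs_of_nonneg (by linarith)] at h3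
  rcases abs_cases (x + w - ((m + 1 : ℤ) : ℝ) * (2 : ℝ) ^ k) with ⟨h4, _⟩ | ⟨h4, _⟩ <;> linarith

lemma natCast_mem (h : WideRange p q) {c : ℕ} (hc : c ≤ 2 ^ (p + 1)) : (c : ℝ) ∈ Fset p q := by
  have h1 := h.add_le
  have h2 := h.emin_le
  have := mul_zpow_mem (p := p) (q := q) (m := c) (k := 0)
    (by rw [Nat.abs_cast]; exact_mod_cast hc) (by omega) (by omega)
  simpa using this

lemma one_mem (h : WideRange p q) : (1 : ℝ) ∈ Fset p q := by
  simpa using natCast_mem h (c := 1) Nat.one_le_two_pow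

lemma two_mem (h : WideRange p q) : (2 : ℝ) ∈ Fset p q := by
  simpa using natCast_mem h (c := 2) (by rw [pow_succ]; have := Nat.one_le_two_pow (n := p); omega)

lemma WideRange.zero_mem (h : WideRange p q) : (0 : ℝ) ∈ Fset p q := FPT.zero_mem h.emin_le_emax

/-- The tie at `2 ^ (p + 1) + 1` is resolved downwards. -/
lemma rv_two_pow_add_one (h : WideRange p q) :
    rv p q (2 ^ (p + 1) + 1) = 2 ^ (p + 1) := by
  set a : ℝ := 2 ^ (p + 1) with ha
  have haF : a ∈ Fset p q := by
    simpa using natCast_mem h (c := 2 ^ (p + 1)) le_rfl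
  set y := rv p q (a + 1) with hy
  have hyF : y ∈ Fset p q := rv_mem h _
  have hle : a ≤ y := le_rv h haF (by linarith)
  have hspec := rv_spec h (a + 1)
  have hp1 : (1 : ℤ) ≤ 2 ^ p := one_le_pow₀ (by norm_num)
  have h1 := h.add_le
  have h2 := h.emin_le
  have ha2 : a + 2 = ((2 ^ p + 1 : ℤ) : ℝ) * (2 : ℝ) ^ ((p + 1 : ℤ) - p) := by
    rw [ha, show (p + 1 : ℤ) - p = 1 by ring]; push_cast; rw [pow_succ]; ring
  have ha2F : a + 2 ∈ Fset p q := by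
    rw [ha2]
    exact mem_Fset_of_le (by rw [abs_of_nonneg (by omega), pow_succ]
                             have : 2 ^ 2 ≤ (2 : ℤ) ^ p :=
                               pow_le_pow_right₀ (by norm_num) h.two_le
                             omega) (by omega) (by omega)
  by_contra hne
  have hlt : a < y := lt_of_le_of_ne hle (Ne.symm hne)
  have hyle : y ≤ a + 2 := rv_le h ha2F (by linarith)
  have hyeq : y = a + 2 := by
    refine le_antisymm hyle ?_
    have hk : (2 : ℝ) ^ ((1 : ℤ) + p) = a := by
      rw [ha, ← zpow_natCast]; congr 1; push_cast; ring
    obtain ⟨m', hm'⟩ := Fset_multiple_of_le (k := 1) hyF (by rw [hk]; exact hle.trans (le_abs_self _))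
    rw [zpow_one] at hm'
    rw [hm'] at hlt ⊢
    have : 2 ^ p + 1 ≤ m' := by
      have : ((2 ^ p : ℤ) : ℝ) < m' := by rw [ha, pow_succ] at hlt; push_cast; linarith
      exact_mod_cast this
    have : ((2 ^ p + 1 : ℤ) : ℝ) ≤ m' := by exact_mod_cast this
    push_cast at this
    rw [ha, pow_succ]; linarith
  rcases hspec.2.2 with hu | hev
  · have := hu a haF (by
      rw [← hy, hyeq]
      rw [show a + 1 - a = 1 by ring, show a + 1 - (a + 2) = -1 by ring]; simp)
    rw [← hy] at this
    linarith
  · rw [← hy, hyeq, ha2] at hev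
    obtain ⟨m, e, hm, he1, he2, hm2, heq, hd⟩ := hev
    have hppos : (0 : ℤ) < 2 ^ p := by positivity
    have hpe : (2 : ℤ) ∣ 2 ^ p := dvd_pow_self 2 (by have := h.two_le; omega)
    rw [pow_succ] at hm
    rcases le_total (p + 1 : ℤ) e with hle' | hle'
    · rw [mul_zpow_eq_natMul m (k := e - p) (j := (p + 1 : ℤ) - p) (by omega)] at heq
      have := mul_right_cancel₀ (zpow_two_pos _).ne' heq
      have h5 : (2 ^ p + 1 : ℤ) = m * 2 ^ (e - ↑p - (↑p + 1 - ↑p)).toNat := by exact_mod_cast this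
      have h6 := hd.mul_right (2 ^ (e - ↑p - (↑p + 1 - ↑p)).toNat)
      rw [← h5] at h6
      omega
    · rw [mul_zpow_eq_natMul (2 ^ p + 1) (k := (p + 1 : ℤ) - p) (j := e - p) (by omega)] at heq
      have := mul_right_cancel₀ (zpow_two_pos _).ne' heq
      have h5 : (2 ^ p + 1 : ℤ) * 2 ^ ((↑p + 1 - ↑p) - (e - ↑p)).toNat = m := by
        exact_mod_cast this
      rcases Nat.eq_zero_or_pos ((↑p + 1 - ↑p) - (e - ↑p)).toNat with h7 | h7
      · rw [h7] at h5; omega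
      · have h8 : (2 : ℤ) ^ 1 ≤ 2 ^ ((↑p + 1 - ↑p) - (e - ↑p)).toNat :=
          pow_le_pow_right₀ (by norm_num) h7
        have := le_abs_self m
        nlinarith

end Rounding

end FPT


namespace FPT

section Counting

variable {p q : ℕ}

/-- The iterated floating-point sum of `c` copies of `w`. -/
noncomputable def countSum (p q : ℕ) (w : ℝ) : ℕ → ℝ
  | 0 => 0
  | c + 1 => rv p q (countSum p q w c + w)

lemma countSum_mem (h : WideRange p q) (w : ℝ) (c : ℕ) : countSum p q w c ∈ Fset p q := by
  cases c with
  | zero => exact h.zero_mem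
  | succ c => exact rv_mem h _

lemma countSum_monotone (h : WideRange p q) {w : ℝ} (hw : 0 ≤ w) :
    Monotone (countSum p q w) :=
  monotone_nat_of_le_succ fun c => le_rv h (countSum_mem h w c) (by linarith)

lemma countSum_nonneg (h : WideRange p q) {w : ℝ} (hw : 0 ≤ w) (c : ℕ) :
    0 ≤ countSum p q w c := countSum_monotone h hw (Nat.zero_le c)

lemma countSum_one_eq (h : WideRange p q) {c : ℕ} (hc : c ≤ 2 ^ (p + 1)) :
    countSum p q 1 c = c := by
  induction c with
  | zero => simp [countSum]
  | succ c ih =>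
    rw [countSum, ih (by omega)]
    have := rv_self h (natCast_mem h hc)
    push_cast at this ⊢
    exact this

lemma countSum_one_of_le (h : WideRange p q) {c : ℕ} (hc : 2 ^ (p + 1) ≤ c) :
    countSum p q 1 c = 2 ^ (p + 1) := by
  induction c, hc using Nat.le_induction with
  | base => rw [countSum_one_eq h le_rfl]; push_cast; rfl
  | succ c hc ih => rw [countSum, ih, rv_two_pow_add_one h]

lemma countSum_le_mul (h : WideRange p q) {w : ℝ} {k : ℤ} (hw : w ≤ (2 : ℝ) ^ k)
    (h1 : emin q - p ≤ k) (h2 : k + p + 1 ≤ emax q) {c : ℕ} (hc : c ≤ 2 ^ (p + 1)) :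
    countSum p q w c ≤ c * (2 : ℝ) ^ k := by
  induction c with
  | zero => simp [countSum]
  | succ c ih =>
    have hm := mul_zpow_mem (p := p) (q := q) (m := ((c + 1 : ℕ) : ℤ)) (k := k)
      (by rw [Nat.abs_cast]; exact_mod_cast hc) h1 h2
    rw [Int.cast_natCast] at hm
    refine rv_le h hm ?_
    have := ih (by omega)
    push_cast
    linarith

lemma countSum_lt_succ_of_small (h : WideRange p q) {w : ℝ} {k : ℤ} (hk : (2 : ℝ) ^ k ≤ w)
    (hw : w < (2 : ℝ) ^ (k + 1)) (h1 : emin q - p ≤ k) (h2 : k + p + 2 ≤ emax q) {c : ℕ}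
    (hc : c < 2 ^ p) : countSum p q w c < countSum p q w (c + 1) := by
  have hpos := zpow_two_pos k
  refine lt_rv_add h (k := k) (countSum_nonneg h (by linarith) c) ?_ h1 (by omega) (by linarith)
  have h3 := countSum_le_mul h hw.le (by omega) (by omega) (c := c)
    (by rw [pow_succ]; omega)
  refine h3.trans_lt ?_
  rw [show k + (p : ℤ) + 1 = p + (k + 1) by ring, zpow_two_add p, zpow_natCast]
  exact mul_lt_mul_of_pos_right (by exact_mod_cast hc) (zpow_two_pos _)

lemma excess_mem (h : WideRange p q) : (1 + (2 : ℝ) ^ (-(p : ℤ))) ∈ Fset p q := by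
  have h1 := h.add_le
  have h2 := h.emin_le
  have hp1 : (1 : ℤ) ≤ 2 ^ p := one_le_pow₀ (by norm_num)
  have := mul_zpow_mem (p := p) (q := q) (m := 2 ^ p + 1) (k := -(p : ℤ))
    (by rw [abs_of_nonneg (by omega), pow_succ]; omega) (by omega) (by omega)
  convert this using 1
  push_cast
  rw [add_mul, ← zpow_natCast, ← zpow_two_add]; simp

lemma excess_le (h : WideRange p q) : (2 : ℝ) ^ (-(p : ℤ)) ≤ 1 / 4 := by
  have h2 := h.two_le
  have := zpow_two_le (a := -(p : ℤ)) (b := -2) (by omega)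
  norm_num at this ⊢
  exact this

lemma countSum_excess_le (h : WideRange p q) {c : ℕ} (hc0 : 1 ≤ c) (hc : c + 1 ≤ 2 ^ (p + 1)) :
    countSum p q (1 + (2 : ℝ) ^ (-(p : ℤ))) c ≤ c + 1 := by
  have hle := excess_le h
  have hpos := zpow_two_pos (-(p : ℤ))
  have hself : rv p q (1 + (2 : ℝ) ^ (-(p : ℤ))) = 1 + (2 : ℝ) ^ (-(p : ℤ)) :=
    rv_self h (excess_mem h)
  have hp4 : 2 ^ 2 ≤ 2 ^ p := Nat.pow_le_pow_right (by norm_num) h.two_le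
  induction c, hc0 using Nat.le_induction with
  | base =>
    simp only [countSum, zero_add, hself]
    push_cast; linarith
  | succ c hc0 ih =>
    have hmem : ((c + 1 : ℕ) : ℝ) + 1 ∈ Fset p q := by
      have := natCast_mem h hc
      push_cast at this ⊢
      exact this
    rcases hc0.eq_or_lt with rfl | hc1
    · simp only [countSum, zero_add, hself]
      refine rv_le h hmem ?_
      push_cast
      linarith
    · have ih := ih (by omega)
      have hc2 : (2 : ℝ) ≤ c := by exact_mod_cast hc1
      have hsplit : (2 : ℝ) ^ (2 - (p : ℤ)) = 4 * (2 : ℝ) ^ (-(p : ℤ)) := by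
        rw [sub_eq_add_neg, zpow_two_add]; norm_num
      rw [countSum]
      refine rv_le_of_excess h (k := 2 - p) hmem ?_ ?_
      · rw [show 2 - (p : ℤ) + p = 2 by ring]
        push_cast
        norm_num
        linarith
      · rw [hsplit]
        push_cast
        linarith

lemma countSum_excess_le' (h : WideRange p q) {c : ℕ} (hc : c ≤ 2 ^ p) :
    countSum p q (1 + (2 : ℝ) ^ (-(p : ℤ))) (2 ^ (p + 1) - 1 + c) ≤ 2 ^ (p + 1) + 2 * c := by
  have hle := excess_le h
  have h1 := h.add_le
  have h2 := h.emin_le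
  have hp1 : 1 ≤ 2 ^ p := Nat.one_le_two_pow
  induction c with
  | zero =>
    have := countSum_excess_le h (c := 2 ^ (p + 1) - 1) (by rw [pow_succ]; omega) (by omega)
    rw [Nat.cast_sub Nat.one_le_two_pow] at this
    push_cast at this ⊢
    simpa using this
  | succ c ih =>
    have ih := ih (by omega)
    have hmem := mul_zpow_mem (p := p) (q := q) (m := 2 ^ p + (c + 1)) (k := 1)
      (by rw [abs_of_nonneg (by positivity), pow_succ]
          have : ((c + 1 : ℕ) : ℤ) ≤ ((2 ^ p : ℕ) : ℤ) := by exact_mod_cast hc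
          push_cast at this
          omega) (by omega) (by omega)
    push_cast at hmem
    rw [← add_assoc, countSum]
    have hrw : (2 : ℝ) ^ (p + 1) + 2 * ((c + 1 : ℕ) : ℝ) = (2 ^ p + (c + 1)) * (2 : ℝ) ^ (1 : ℤ) := by
      push_cast; rw [pow_succ, zpow_one]; ring
    rw [hrw]
    refine rv_le h hmem ?_
    rw [← hrw]; push_cast; linarith

lemma two_pow_add_two (p : ℕ) : (2 : ℝ) ^ (p + 2) = (2 : ℝ) ^ ((p : ℤ) + 2) := by
  rw [← zpow_natCast]; norm_cast

lemma two_pow_mem (h : WideRange p q) : (2 : ℝ) ^ (p + 2) ∈ Fset p q := by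
  have h1 := h.add_le
  have h2 := h.emin_le
  rw [two_pow_add_two]
  exact zpow_mem h.emin_le_emax (by omega) (by omega)

lemma countSum_excess_le_two_pow (h : WideRange p q) (c : ℕ) :
    countSum p q (1 + (2 : ℝ) ^ (-(p : ℤ))) c ≤ 2 ^ (p + 2) := by
  have hle := excess_le h
  induction c with
  | zero => simp [countSum]
  | succ c ih =>
    refine rv_le_of_excess h (k := 2) (two_pow_mem h) ?_ ?_
    · rw [two_pow_add_two, add_comm]
    · have h4 : (2 : ℝ) ^ (2 : ℤ) = 4 := by norm_num
      linarith

lemma countSum_excess_lt_succ (h : WideRange p q) {c : ℕ} (hc : c < 3 * 2 ^ p - 1) :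
    countSum p q (1 + (2 : ℝ) ^ (-(p : ℤ))) c < countSum p q (1 + (2 : ℝ) ^ (-(p : ℤ))) (c + 1) := by
  have hpos := zpow_two_pos (-(p : ℤ))
  have h1 := h.add_le
  have h2 := h.emin_le
  refine lt_rv_add h (k := 1) (countSum_nonneg h (by linarith) c) ?_ (by omega) (by omega)
    (by rw [zpow_one]; linarith)
  have hp1 : 1 ≤ 2 ^ p := Nat.one_le_two_pow
  have hpp : 2 ^ (p + 1) = 2 * 2 ^ p := by rw [pow_succ]; ring
  have h3 := countSum_monotone h (w := 1 + (2 : ℝ) ^ (-(p : ℤ))) (by linarith)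
    (show c ≤ 2 ^ (p + 1) - 1 + (2 ^ p - 1) by omega)
  have h4 := countSum_excess_le' h (c := 2 ^ p - 1) (by omega)
  rw [Nat.cast_sub hp1] at h4
  push_cast at h4
  have h5 : (2 : ℝ) ^ ((1 : ℤ) + p + 1) = 2 ^ (p + 1) + 2 * 2 ^ p := by
    rw [show (1 : ℤ) + p + 1 = p + 2 by ring, ← two_pow_add_two]; ring
  rw [h5]
  linarith

lemma two_pow_add_two_le_Omega (h : WideRange p q) : (2 : ℝ) ^ (p + 2) + 2 ≤ Omega p q := by
  have hle := excess_le h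
  have h1 := h.add_le
  have h2 := zpow_two_le h1
  rw [← two_pow_add_two] at h2
  have h3 : (2 : ℝ) ^ 2 ≤ 2 ^ p := pow_le_pow_right₀ (by norm_num) h.two_le
  rw [pow_add] at h2 ⊢
  unfold Omega
  nlinarith

/-- There is a value weight whose product with the uniform attention weight on `n` tokens has
iterated sums that count up to half of `n`. -/
lemma exists_counting_weight (h : WideRange p q) {n : ℕ} (hn0 : 0 < n) (hn : n ≤ 6 * 2 ^ p - 2) :
    ∃ V ∈ Fset p q, ∃ w ∈ Fset p q, ∃ T : ℕ, 0 ≤ w ∧ w ≤ 2 ∧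
      fmul p q (.fin V) (.fin (rv p q (1 / countSum p q 1 n))) = .fin w ∧ n ≤ 2 * T ∧
      (∀ c < T, countSum p q w c < countSum p q w (c + 1)) ∧
      ∀ c ≤ n, countSum p q w c ≤ 2 ^ (p + 2) := by
  have h1 := h.add_le
  have h2 := h.emin_le
  have hpp : 2 ^ (p + 1) = 2 * 2 ^ p := by rw [pow_succ]; ring
  rcases lt_or_ge n (2 ^ (p + 1)) with hlt | hge
  · rw [countSum_one_eq h hlt.le]
    set w := rv p q (1 / (n : ℝ)) with hw
    have hn0' : (1 : ℝ) ≤ n := by exact_mod_cast hn0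
    have hw1 : w ≤ 1 := rv_le h (one_mem h) (by rw [div_le_one (by linarith)]; exact hn0')
    have hlow : (2 : ℝ) ^ (-(p : ℤ) - 1) ≤ w := by
      refine le_rv h (zpow_mem h.emin_le_emax (by omega) (by omega)) ?_
      rw [show -(p : ℤ) - 1 = -((p + 1 : ℕ) : ℤ) by push_cast; ring, zpow_neg, zpow_natCast,
        ← one_div]
      exact one_div_le_one_div_of_le (by linarith) (by exact_mod_cast hlt.le)
    have hwpos : 0 < w := lt_of_lt_of_le (zpow_two_pos _) hlow
    obtain ⟨k, hk1, hk2⟩ := exists_mem_Ico_zpow (y := (2 : ℝ)) hwpos (by norm_num)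
    have hkl : -(p : ℤ) - 1 < k + 1 :=
      (zpow_lt_zpow_iff_right₀ (by norm_num : (1 : ℝ) < 2)).1 (hlow.trans_lt hk2)
    have hku : k ≤ 0 :=
      (zpow_le_zpow_iff_right₀ (by norm_num : (1 : ℝ) < 2)).1 (by simpa using hk1.trans hw1)
    refine ⟨1, one_mem h, w, rv_mem h _, 2 ^ p, hwpos.le, by linarith, ?_, by omega, ?_, ?_⟩
    · simp only [fmul, one_mul]
      exact rnd_self h (rv_mem h _)
    · intro c hc
      exact countSum_lt_succ_of_small h hk1 hk2 (by omega) (by omega) hc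
    · intro c hc
      have h3 := countSum_le_mul h (w := w) (k := 0) (by simpa using hw1) (by omega) (by omega)
        (c := c) (by omega)
      have h4 : (c : ℝ) ≤ 2 ^ (p + 1) := by exact_mod_cast (hc.trans hlt.le)
      have h5 : (2 : ℝ) ^ (p + 1) ≤ 2 ^ (p + 2) := pow_le_pow_right₀ (by norm_num) (by omega)
      simp only [zpow_zero, mul_one] at h3
      linarith
  · rw [countSum_one_of_le h hge]
    have hσ : (1 : ℝ) / 2 ^ (p + 1) = (2 : ℝ) ^ (-(p : ℤ) - 1) := by
      rw [show -(p : ℤ) - 1 = -((p + 1 : ℕ) : ℤ) by push_cast; ring, zpow_neg, zpow_natCast,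
        ← one_div]
    rw [hσ, rv_self h (zpow_mem h.emin_le_emax (by omega) (by omega))]
    have hp1 : (1 : ℤ) ≤ 2 ^ p := one_le_pow₀ (by norm_num)
    have hV := mul_zpow_mem (p := p) (q := q) (m := 2 ^ p + 1) (k := 1)
      (by rw [abs_of_nonneg (by omega), pow_succ]; omega) (by omega) (by omega)
    have hpos := zpow_two_pos (-(p : ℤ))
    have hle := excess_le h
    refine ⟨_, hV, _, excess_mem h, 3 * 2 ^ p - 1, by linarith, by linarith, ?_, by omega,
      fun c hc => countSum_excess_lt_succ h hc, fun c _ => countSum_excess_le_two_pow h c⟩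
    simp only [fmul]
    rw [← rnd_self h (excess_mem h)]
    congr 1
    rw [mul_assoc, ← zpow_two_add, show 1 + (-(p : ℤ) - 1) = -p by ring]
    push_cast
    rw [add_mul, ← zpow_natCast, ← zpow_two_add]; simp

end Counting

end FPT


namespace FPT

section Sums

variable {p q : ℕ}

lemma fadd_valid (h : WideRange p q) (x y : EF) : (fadd p q x y).Valid p q := by
  cases x <;> cases y <;> first | exact rnd_valid h _ | trivial

lemma fmul_fin_valid (h : WideRange p q) (x y : ℝ) :
    (fmul p q (.fin x) (.fin y)).Valid p q := rnd_valid h _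

lemma fadd_zero_right (h : WideRange p q) {x : EF} (hx : x.Valid p q) :
    fadd p q x (.fin 0) = x := by
  cases x with
  | fin x => simp only [fadd, add_zero]; exact rnd_self h hx
  | _ => rfl

lemma fadd_zero_left (h : WideRange p q) {x : EF} (hx : x.Valid p q) :
    fadd p q (.fin 0) x = x := by
  cases x with
  | fin x => simp only [fadd, zero_add]; exact rnd_self h hx
  | _ => rfl

lemma fadd_comm_fin (x y : ℝ) : fadd p q (.fin x) (.fin y) = fadd p q (.fin y) (.fin x) := by
  simp only [fadd, add_comm]

lemma fmul_one_left (h : WideRange p q) {x : ℝ} (hx : x ∈ Fset p q) :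
    fmul p q (.fin 1) (.fin x) = .fin x := by
  simp only [fmul, one_mul]; exact rnd_self h hx

lemma fmul_one_right (h : WideRange p q) {x : ℝ} (hx : x ∈ Fset p q) :
    fmul p q (.fin x) (.fin 1) = .fin x := by
  simp only [fmul, mul_one]; exact rnd_self h hx

lemma fmul_zero_left (h : WideRange p q) (x : ℝ) : fmul p q (.fin 0) (.fin x) = .fin 0 := by
  simp only [fmul, zero_mul]; exact rnd_self h h.zero_mem

lemma fmul_zero_right (h : WideRange p q) (x : ℝ) : fmul p q (.fin x) (.fin 0) = .fin 0 := by
  simp only [fmul, mul_zero]; exact rnd_self h h.zero_mem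

lemma fsuml_eq_foldl (h : WideRange p q) {l : List EF} (hl : ∀ x ∈ l, x.Valid p q) :
    fsuml p q l = l.foldl (fadd p q) (.fin 0) := by
  cases l with
  | nil => rfl
  | cons x xs =>
    rw [List.foldl_cons, fadd_zero_left h (hl x (by simp))]; rfl

/-- Zero summands may be dropped from a floating-point sum. -/
lemma foldl_fadd_filter (h : WideRange p q) {ι : Type*} {v : ι → EF} {P : ι → Prop}
    [DecidablePred P]
    (h0 : ∀ j, ¬ P j → v j = .fin 0) (l : List ι) {acc : EF} (hacc : acc.Valid p q) :
    (l.map v).foldl (fadd p q) acc = ((l.filter P).map v).foldl (fadd p q) acc := by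
  induction l generalizing acc with
  | nil => rfl
  | cons j l ih =>
    by_cases hj : P j
    · simp only [List.map_cons, List.foldl_cons, List.filter_cons, hj, decide_true, if_true]
      exact ih (fadd_valid h _ _)
    · simp only [List.map_cons, List.foldl_cons, List.filter_cons, hj, decide_false,
        h0 j hj, fadd_zero_right h hacc]
      simpa using ih hacc

lemma fsum_eq_filter (h : WideRange p q) {n : ℕ} {v : Fin n → EF} {P : Fin n → Prop}
    [DecidablePred P]
    (hv : ∀ j, (v j).Valid p q) (h0 : ∀ j, ¬ P j → v j = .fin 0) :
    fsum p q v = (((List.finRange n).filter P).map v).foldl (fadd p q) (.fin 0) := by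
  unfold fsum
  rw [fsuml_eq_foldl h (by simpa using hv)]
  exact foldl_fadd_filter h h0 _ h.zero_mem

lemma fsum_one {v : Fin 1 → EF} : fsum p q v = v 0 := rfl

lemma fsum_zero (h : WideRange p q) {n : ℕ} {v : Fin n → EF} (h0 : ∀ j, v j = .fin 0) :
    fsum p q v = .fin 0 := by
  rw [fsum_eq_filter h (P := fun _ => False) (fun j => by rw [h0]; exact h.zero_mem)
    (fun j _ => h0 j)]
  simp

lemma fsum_single (h : WideRange p q) {n : ℕ} {v : Fin n → EF} (i : Fin n)
    (hv : (v i).Valid p q) (h0 : ∀ j, j ≠ i → v j = .fin 0) : fsum p q v = v i := by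
  have hval : ∀ j, (v j).Valid p q := fun j => by
    by_cases hj : j = i
    · rwa [hj]
    · rw [h0 j hj]; exact h.zero_mem
  rw [fsum_eq_filter h (P := fun j => j = i) hval h0]
  have : (List.finRange n).filter (fun j => decide (j = i)) = [i] := by
    rw [← List.perm_singleton]
    refine (List.perm_ext_iff_of_nodup ((List.nodup_finRange n).filter _) (by simp)).2 ?_
    simp
  rw [this]
  simp [fadd_zero_left h hv]

lemma fsum_pair (h : WideRange p q) {n : ℕ} {v : Fin n → EF} {i j : Fin n} (hij : i ≠ j)
    {a b : ℝ} (ha : a ∈ Fset p q) (hb : b ∈ Fset p q) (hi : v i = .fin a) (hj : v j = .fin b)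
    (h0 : ∀ k, k ≠ i → k ≠ j → v k = .fin 0) :
    fsum p q v = fadd p q (.fin a) (.fin b) := by
  have hval : ∀ k, (v k).Valid p q := fun k => by
    by_cases hk : k = i
    · rw [hk, hi]; exact ha
    · by_cases hk' : k = j
      · rw [hk', hj]; exact hb
      · rw [h0 k hk hk']; exact h.zero_mem
  rw [fsum_eq_filter h (P := fun k => k = i ∨ k = j) hval
    (fun k hk => h0 k (fun e => hk (Or.inl e)) (fun e => hk (Or.inr e)))]
  have : (List.finRange n).filter (fun k => decide (k = i ∨ k = j)) = [i, j] ∨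
      (List.finRange n).filter (fun k => decide (k = i ∨ k = j)) = [j, i] := by
    rw [← List.perm_pair]
    refine (List.perm_ext_iff_of_nodup ((List.nodup_finRange n).filter _) (by simp [hij])).2 ?_
    simp
  rcases this with e | e <;> rw [e] <;>
    simp only [List.map_cons, List.map_nil, List.foldl_cons, List.foldl_nil, hi, hj]
  · rw [fadd_zero_left h (x := .fin a) ha]
  · rw [fadd_zero_left h (x := .fin b) hb, fadd_comm_fin]

lemma foldl_fadd_const {w : ℝ} {ι : Type*} (l : List ι) (a : ℕ)
    (hb : ∀ c < a + l.length, |countSum p q w c + w| ≤ Omega p q) :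
    (l.map fun _ => EF.fin w).foldl (fadd p q) (.fin (countSum p q w a)) =
      .fin (countSum p q w (a + l.length)) := by
  induction l generalizing a with
  | nil => rfl
  | cons x l ih =>
    simp only [List.length_cons] at hb
    simp only [List.map_cons, List.foldl_cons, List.length_cons]
    rw [fadd, rnd_eq (hb a (by omega))]
    have := ih (a + 1) (fun c hc => hb c (by omega))
    rw [countSum] at this
    rw [this]; congr 2; omega

/-- The floating-point sum of an indicator vector scaled by `w` depends only on the number of
nonzero entries. -/
lemma fsum_indicator (h : WideRange p q) {n : ℕ} {v : Fin n → EF} {P : Fin n → Prop}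
    [DecidablePred P] {w : ℝ}
    (hw : w ∈ Fset p q) (hv : ∀ j, v j = .fin (if P j then w else 0))
    (hb : ∀ c < n, |countSum p q w c + w| ≤ Omega p q) :
    fsum p q v = .fin (countSum p q w (Finset.univ.filter P).card) := by
  have hval : ∀ k, (v k).Valid p q := fun k => by
    rw [hv k]; split_ifs
    · exact hw
    · exact h.zero_mem
  rw [fsum_eq_filter h (P := P) hval (fun j hj => by rw [hv j, if_neg hj])]
  have hmap : ((List.finRange n).filter P).map v =
      ((List.finRange n).filter P).map fun _ => EF.fin w := by
    refine List.map_congr_left fun j hj => ?_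
    rw [hv j, if_pos (by simpa using hj)]
  have hlen : ((List.finRange n).filter P).length = (Finset.univ.filter P).card := by
    rw [← List.toFinset_card_of_nodup ((List.nodup_finRange n).filter _)]
    congr 1
    ext j; simp
  have hle : (Finset.univ.filter P).card ≤ n := by
    simpa using Finset.card_le_univ (Finset.univ.filter P)
  rw [hmap]
  have := foldl_fadd_const (p := p) (q := q) (w := w) ((List.finRange n).filter P) 0
    (fun c hc => hb c (by omega))
  rw [hlen, zero_add] at this
  exact this

end Sums

section Layers

variable {p q : ℕ}

/-- A block with one head, head dimension one, one hidden neuron and uniform attention. -/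
def mkBlock {d : ℕ} (wv wo w1 w2 : Fin d → ℝ) (b : ℝ) : Block 1 1 1 d where
  WK := fun _ _ _ => 0
  WQ := fun _ _ _ => 0
  WV := fun _ _ => wv
  WO := fun _ j _ => wo j
  W1 := fun _ => w1
  W2 := fun j _ => w2 j
  b1 := fun _ => b
  b2 := fun _ => 0

lemma mkBlock_valid (h : WideRange p q) {d : ℕ} {wv wo w1 w2 : Fin d → ℝ} {b : ℝ}
    (hwv : ∀ j, wv j ∈ Fset p q) (hwo : ∀ j, wo j ∈ Fset p q) (hw1 : ∀ j, w1 j ∈ Fset p q)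
    (hw2 : ∀ j, w2 j ∈ Fset p q) (hb : b ∈ Fset p q) : (mkBlock wv wo w1 w2 b).Valid p q :=
  ⟨fun _ _ _ => h.zero_mem, fun _ _ _ => h.zero_mem, fun _ _ => hwv, fun _ j _ => hwo j,
    fun _ => hw1, fun j _ => hw2 j, fun _ => hb, fun _ => h.zero_mem⟩

lemma mmul_zero_left (h : WideRange p q) {a b c : ℕ} (x : Fin b → Fin c → ℝ) :
    mmul p q (fun (_ : Fin a) _ => .fin 0) (toEF x) = fun _ _ => .fin 0 := by
  funext i k
  exact fsum_zero h fun j => fmul_zero_left h _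

lemma vmax_zero {n : ℕ} (hn : 0 < n) : vmax (fun _ : Fin n => EF.fin 0) = .fin 0 := by
  have key : ∀ (l : List (Fin n)), (l.map fun _ => EF.fin 0).foldl emax2 (.fin 0) = .fin 0 := by
    intro l
    induction l with
    | nil => rfl
    | cons x l ih => simpa [emax2] using ih
  obtain ⟨m, rfl⟩ := Nat.exists_eq_succ_of_ne_zero hn.ne'
  unfold vmax
  rw [List.finRange_succ, List.map_cons, List.foldl_cons]
  simpa [emax2, Function.comp_def] using key ((List.finRange m).map Fin.succ)

lemma countSum_one_le (h : WideRange p q) (c : ℕ) : countSum p q 1 c ≤ 2 ^ (p + 2) := by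
  have h5 : (2 : ℝ) ^ (p + 1) ≤ 2 ^ (p + 2) := pow_le_pow_right₀ (by norm_num) (by omega)
  rcases le_total c (2 ^ (p + 1)) with hc | hc
  · rw [countSum_one_eq h hc]
    have : (c : ℝ) ≤ 2 ^ (p + 1) := by exact_mod_cast hc
    linarith
  · rw [countSum_one_of_le h hc]; exact h5

lemma abs_countSum_add_le (h : WideRange p q) {w : ℝ} (hw0 : 0 ≤ w) (hw : w ≤ 2) {c : ℕ}
    (hc : countSum p q w c ≤ 2 ^ (p + 2)) : |countSum p q w c + w| ≤ Omega p q := by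
  have := countSum_nonneg h hw0 c
  rw [abs_of_nonneg (by linarith)]
  linarith [two_pow_add_two_le_Omega h]

lemma fsoftmax_zero (h : WideRange p q) {n : ℕ} (hn : 0 < n) (i : Fin n) :
    fsoftmax p q (fun _ : Fin n => EF.fin 0) i = .fin (rv p q (1 / countSum p q 1 n)) := by
  have he : fexp p q (fsub p q (.fin 0) (.fin 0)) = .fin 1 := by
    unfold fsub
    rw [fmul_zero_right h, fadd_zero_right h (x := .fin 0) h.zero_mem]
    simp only [fexp, Real.exp_zero]
    exact rnd_self h (one_mem h)
  unfold fsoftmax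
  rw [vmax_zero hn, he, fsum_indicator h (P := fun _ => True) (w := 1) (one_mem h)
    (fun j => by rw [he]; simp)
    (fun c _ => abs_countSum_add_le h zero_le_one (by norm_num) (countSum_one_le h c))]
  have h1 : (1 : ℝ) ≤ countSum p q 1 n := by
    have := countSum_monotone h zero_le_one (show 1 ≤ n from hn)
    rw [countSum_one_eq h Nat.one_le_two_pow] at this
    simpa using this
  simp only [Finset.filter_true, Finset.card_univ, Fintype.card_fin, fdiv]
  rw [if_pos (by linarith), rnd_eq]
  rw [abs_of_nonneg (by positivity)]
  refine le_trans ?_ (two_pow_add_two_le_Omega h)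
  have h3 : 1 / countSum p q 1 n ≤ 1 := by rw [div_le_one (by linarith)]; exact h1
  have : (0 : ℝ) ≤ 2 ^ (p + 2) := by positivity
  linarith

lemma attnApply_mkBlock (h : WideRange p q) {d n : ℕ} (hn : 0 < n) {wv wo w1 w2 : Fin d → ℝ}
    {b : ℝ} {x : Fin d → Fin n → ℝ} (a : Fin d) (t : Fin n) :
    attnApply p q (mkBlock wv wo w1 w2 b) (toEF x) a t =
      fadd p q (.fin (x a t)) (fmul p q (.fin (wo a)) (fsum p q fun u : Fin n =>
        fmul p q (fsum p q fun j : Fin d => fmul p q (.fin (wv j)) (.fin (x j u)))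
          (.fin (rv p q (1 / countSum p q 1 n))))) := by
  have h0 : ∀ (k : ℕ), mmul p q (toEF (fun (_ : Fin k) (_ : Fin d) => (0 : ℝ))) (toEF x)
      = fun _ _ => .fin 0 := fun k => mmul_zero_left h x
  have h1 : mmul p q (fun (_ : Fin n) (_ : Fin 1) => EF.fin 0) (fun (_ : Fin 1) (_ : Fin n) => .fin 0)
      = fun _ _ => .fin 0 := mmul_zero_left h (fun _ _ => 0)
  unfold attnApply madd
  simp only [fsum_one, mkBlock]
  rw [h0 1, h1]
  have h2 : colSoftmax p q (fun (_ : Fin n) (_ : Fin n) => EF.fin 0)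
      = fun _ _ => .fin (rv p q (1 / countSum p q 1 n)) := by
    funext i j
    exact fsoftmax_zero h hn i
  rw [h2]
  rfl

lemma ffApply_mkBlock (h : WideRange p q) {d n : ℕ} {wv wo w1 w2 : Fin d → ℝ}
    {b : ℝ} {x : Fin d → Fin n → ℝ} (hw2 : ∀ a, w2 a = 0 ∨ w2 a = 1) (a : Fin d) (t : Fin n) {r : ℝ}
    (hr : frelu p q (fadd p q (fsum p q fun j : Fin d => fmul p q (.fin (w1 j)) (.fin (x j t)))
      (.fin b)) = .fin r) (hrF : r ∈ Fset p q) :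
    ffApply p q (mkBlock wv wo w1 w2 b) (toEF x) a t =
      fadd p q (.fin (x a t)) (.fin (w2 a * r)) := by
  have h1 : ffApply p q (mkBlock wv wo w1 w2 b) (toEF x) a t =
      fadd p q (.fin (x a t)) (fadd p q (fmul p q (.fin (w2 a))
        (frelu p q (fadd p q (fsum p q fun j : Fin d => fmul p q (.fin (w1 j)) (.fin (x j t)))
      (.fin b)))) (.fin 0)) := rfl
  rw [h1, hr]
  congr 1
  rcases hw2 a with e | e <;> rw [e]
  · rw [fmul_zero_left h, zero_mul, fadd_zero_left h (x := .fin 0) h.zero_mem]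
  · rw [fmul_one_left h hrF, one_mul, fadd_zero_right h (x := .fin r) hrF]

end Layers

end FPT


namespace FPT

section Features

variable {p q din n : ℕ}

/-- Matrices of finite floats. -/
abbrev FloatMat (p q din n : ℕ) := Fin din → Fin n → Fset p q

/-- A real-valued quantity attached to every column of an input matrix. -/
abbrev Feature (p q din n : ℕ) := FloatMat p q din n → Fin n → ℝ

/-- All values of the feature are floats. -/
def Feature.IsFloat (φ : Feature p q din n) : Prop := ∀ X t, φ X t ∈ Fset p q

/-- The hidden state whose rows are the listed features, padded by zero rows. -/
def stateMat (d : ℕ) (Φ : List (Feature p q din n)) (X : FloatMat p q din n) :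
    Fin d → Fin n → ℝ := fun i t => Φ.getD i 0 X t

lemma stateMat_mem (h : WideRange p q) {d : ℕ} {Φ : List (Feature p q din n)}
    (hΦ : ∀ φ ∈ Φ, φ.IsFloat) (X : FloatMat p q din n) (i : Fin d) (t : Fin n) :
    stateMat d Φ X i t ∈ Fset p q := by
  unfold stateMat
  by_cases hi : (i : ℕ) < Φ.length
  · rw [List.getD_eq_getElem _ _ hi]
    exact hΦ _ (List.getElem_mem _) X t
  · rw [List.getD_eq_default _ _ (by omega)]
    exact h.zero_mem

lemma fadd_stateMat_append (h : WideRange p q) {d : ℕ} {Φ : List (Feature p q din n)}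
    {χ : Feature p q din n} (hΦ : ∀ φ ∈ Φ, φ.IsFloat) (hχ : χ.IsFloat)
    (X : FloatMat p q din n) (i : Fin d) (t : Fin n) :
    fadd p q (.fin (stateMat d Φ X i t)) (.fin ((if (i : ℕ) = Φ.length then 1 else 0) * χ X t)) =
      .fin (stateMat d (Φ ++ [χ]) X i t) := by
  have hm := stateMat_mem h hΦ X i t
  rcases lt_trichotomy (i : ℕ) Φ.length with hi | hi | hi
  · rw [if_neg hi.ne, zero_mul, fadd_zero_right h (x := .fin _) hm]
    simp [stateMat, List.getElem?_append_left hi]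
  · rw [if_pos hi, one_mul]
    have h0 : stateMat d Φ X i t = 0 := by simp [stateMat, hi]
    rw [h0, fadd_zero_left h (x := .fin _) (hχ X t)]
    simp [stateMat, hi]
  · rw [if_neg hi.ne', zero_mul, fadd_zero_right h (x := .fin _) hm]
    have h1 : Φ[(i : ℕ)]? = none := by simp [hi.le]
    have h2 : (Φ ++ [χ])[(i : ℕ)]? = none := by simp; omega
    simp [stateMat, h1, h2]

/-- The feature `χ` can be appended to the state `Φ` by one transformer block. -/
def Appendable (Φ : List (Feature p q din n)) (χ : Feature p q din n) : Prop :=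
  χ.IsFloat ∧ ∀ d, Φ.length + 1 ≤ d → ∃ B : Block 1 1 1 d, B.Valid p q ∧
    ∀ X, B.apply p q (toEF (stateMat d Φ X)) = toEF (stateMat d (Φ ++ [χ]) X)

lemma single_mem (h : WideRange p q) {d : ℕ} {c : ℝ} (hc : c ∈ Fset p q) (i j : Fin d) :
    (Pi.single i c : Fin d → ℝ) j ∈ Fset p q := by
  rw [Pi.single_apply]; split_ifs
  · exact hc
  · exact h.zero_mem

lemma indicator_mem (h : WideRange p q) (P : Prop) [Decidable P] :
    (if P then 1 else 0 : ℝ) ∈ Fset p q := by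
  split_ifs
  · exact one_mem h
  · exact h.zero_mem

/-- A feed-forward neuron appends its output to the state. -/
lemma appendable_of_neuron (h : WideRange p q) (hn : 0 < n) {Φ : List (Feature p q din n)}
    {χ : Feature p q din n} (hΦ : ∀ φ ∈ Φ, φ.IsFloat) (hχ : χ.IsFloat) {b : ℝ} (hb : b ∈ Fset p q)
    (hw : ∀ d, Φ.length + 1 ≤ d → ∃ w : Fin d → ℝ, (∀ j, w j ∈ Fset p q) ∧ ∀ X t,
      frelu p q (fadd p q (fsum p q fun j : Fin d => fmul p q (.fin (w j))
        (.fin (stateMat d Φ X j t))) (.fin b)) = .fin (χ X t)) : Appendable Φ χ := by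
  refine ⟨hχ, fun d hd => ?_⟩
  obtain ⟨w, hwF, hw⟩ := hw d hd
  refine ⟨mkBlock 0 0 w (fun i => if (i : ℕ) = Φ.length then 1 else 0) b,
    mkBlock_valid h (fun _ => h.zero_mem) (fun _ => h.zero_mem) hwF
      (fun _ => indicator_mem h _) hb, fun X => ?_⟩
  have hat : attnApply p q (mkBlock 0 0 w (fun i : Fin d => if (i : ℕ) = Φ.length then 1 else 0) b)
      (toEF (stateMat d Φ X)) = toEF (stateMat d Φ X) := by
    funext a t
    rw [attnApply_mkBlock h hn]
    have h0 : (fun u : Fin n => fmul p q (fsum p q fun j : Fin d =>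
        fmul p q (.fin ((0 : Fin d → ℝ) j)) (.fin (stateMat d Φ X j u)))
          (.fin (rv p q (1 / countSum p q 1 n)))) = fun _ => .fin 0 := by
      funext u
      simp only [Pi.zero_apply]
      rw [fsum_zero h (fun j => fmul_zero_left h _), fmul_zero_left h]
    rw [h0, fsum_zero h (fun _ => rfl), fmul_zero_right h,
      fadd_zero_right h (x := .fin _) (stateMat_mem h hΦ X a t)]
    rfl
  funext a t
  unfold Block.apply
  rw [hat, ffApply_mkBlock h (fun a => by split_ifs <;> simp) a t (hw X t) (hχ X t)]
  exact fadd_stateMat_append h hΦ hχ X a t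

/-- A uniform attention head appends the rounded count of the columns marked by a feature. -/
lemma appendable_count (h : WideRange p q) (hn : 0 < n) {Φ : List (Feature p q din n)}
    (hΦ : ∀ φ ∈ Φ, φ.IsFloat) {V w : ℝ} (hV : V ∈ Fset p q) (hw : w ∈ Fset p q) (hw0 : 0 ≤ w)
    (hw2 : w ≤ 2) (hVw : fmul p q (.fin V) (.fin (rv p q (1 / countSum p q 1 n))) = .fin w)
    (hc : ∀ c ≤ n, countSum p q w c ≤ 2 ^ (p + 2)) (P : FloatMat p q din n → Fin n → Prop)
    (hP : (fun X t => if P X t then 1 else 0) ∈ Φ) :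
    Appendable Φ fun X _ => countSum p q w (Finset.univ.filter (P X)).card := by
  have hχ : Feature.IsFloat (p := p) (q := q) (din := din) (n := n)
      fun X _ => countSum p q w (Finset.univ.filter (P X)).card := fun X _ => countSum_mem h _ _
  refine ⟨hχ, fun d hd => ?_⟩
  obtain ⟨i, hi, hPi⟩ := List.mem_iff_getElem.1 hP
  set i' : Fin d := ⟨i, by omega⟩ with hi'
  have hrow : ∀ X u, stateMat d Φ X i' u = if P X u then 1 else 0 := fun X u => by
    unfold stateMat
    rw [List.getD_eq_getElem _ _ hi, hPi]
  refine ⟨mkBlock (Pi.single i' V) (fun i => if (i : ℕ) = Φ.length then 1 else 0) 0 0 0,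
    mkBlock_valid h (single_mem h hV i') (fun _ => indicator_mem h _) (fun _ => h.zero_mem)
      (fun _ => h.zero_mem) h.zero_mem, fun X => ?_⟩
  have hat : attnApply p q (mkBlock (Pi.single i' V)
      (fun i : Fin d => if (i : ℕ) = Φ.length then 1 else 0) 0 0 0)
      (toEF (stateMat d Φ X)) = toEF (stateMat d (Φ ++
        [fun X _ => countSum p q w (Finset.univ.filter (P X)).card]) X) := by
    funext a t
    rw [attnApply_mkBlock h hn]
    have h0 : ∀ u : Fin n, fmul p q (fsum p q fun j : Fin d =>
        fmul p q (.fin ((Pi.single i' V : Fin d → ℝ) j)) (.fin (stateMat d Φ X j u)))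
          (.fin (rv p q (1 / countSum p q 1 n))) = .fin (if P X u then w else 0) := by
      intro u
      rw [fsum_single h i' (fmul_fin_valid h _ _) (fun j hj => by
        rw [Pi.single_eq_of_ne hj, fmul_zero_left h]), Pi.single_eq_same, hrow]
      split_ifs
      · rw [fmul_one_right h hV, hVw]
      · rw [fmul_zero_right h, fmul_zero_left h]
    rw [fsum_indicator h (P := P X) hw h0 (fun c hcn =>
      abs_countSum_add_le h hw0 hw2 (hc c hcn.le))]
    have h1 := fadd_stateMat_append h hΦ hχ X a t
    rw [toEF, ← h1]
    congr 1
    split_ifs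
    · rw [fmul_one_left h (countSum_mem h _ _), one_mul]
    · rw [fmul_zero_left h, zero_mul]
  have hΦ' : ∀ φ ∈ Φ ++ [fun X _ => countSum p q w (Finset.univ.filter (P X)).card],
      Feature.IsFloat φ := by
    intro φ hφ
    rcases List.mem_append.1 hφ with hφ | hφ
    · exact hΦ φ hφ
    · rw [List.mem_singleton.1 hφ]; exact hχ
  funext a t
  unfold Block.apply
  rw [hat, ffApply_mkBlock h (w2 := 0) (fun a => Or.inl rfl) a t (r := 0) ?_ h.zero_mem]
  · simp only [Pi.zero_apply, mul_zero]
    rw [fadd_zero_right h (x := .fin _) (stateMat_mem h hΦ' X a t)]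
    rfl
  · simp only [Pi.zero_apply]
    rw [fsum_zero h (fun j => fmul_zero_left h _), fadd_zero_right h (x := .fin 0) h.zero_mem]
    simp only [frelu, max_self]
    exact rnd_self h h.zero_mem

lemma appendable_unary (h : WideRange p q) (hn : 0 < n) {Φ : List (Feature p q din n)}
    {φ χ : Feature p q din n} (hΦ : ∀ φ ∈ Φ, φ.IsFloat) (hφ : φ ∈ Φ) (hχ : χ.IsFloat) {a b : ℝ}
    (ha : a ∈ Fset p q) (hb : b ∈ Fset p q)
    (hr : ∀ X t, frelu p q (fadd p q (fmul p q (.fin a) (.fin (φ X t))) (.fin b)) =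
      .fin (χ X t)) : Appendable Φ χ := by
  refine appendable_of_neuron h hn hΦ hχ hb fun d hd => ?_
  obtain ⟨i, hi, rfl⟩ := List.mem_iff_getElem.1 hφ
  set i' : Fin d := ⟨i, by omega⟩ with hi'
  refine ⟨Pi.single i' a, single_mem h ha i', fun X t => ?_⟩
  rw [fsum_single h i' (fmul_fin_valid h _ _) (fun j hj => by
        rw [Pi.single_eq_of_ne hj, fmul_zero_left h]), Pi.single_eq_same, ← hr X t]
  unfold stateMat
  rw [List.getD_eq_getElem _ _ hi]

lemma appendable_add (h : WideRange p q) (hn : 0 < n) {Φ : List (Feature p q din n)}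
    {φ ψ χ : Feature p q din n} (hΦ : ∀ φ ∈ Φ, φ.IsFloat) (hφ : φ ∈ Φ) (hψ : ψ ∈ Φ) (hne : φ ≠ ψ)
    (hχ : χ.IsFloat) {b : ℝ} (hb : b ∈ Fset p q)
    (hr : ∀ X t, frelu p q (fadd p q (fadd p q (.fin (φ X t)) (.fin (ψ X t))) (.fin b)) =
      .fin (χ X t)) : Appendable Φ χ := by
  refine appendable_of_neuron h hn hΦ hχ hb fun d hd => ?_
  obtain ⟨i, hi, hi1⟩ := List.mem_iff_getElem.1 hφ
  obtain ⟨j, hj, hj1⟩ := List.mem_iff_getElem.1 hψ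
  have hij : i ≠ j := by rintro rfl; exact hne (hi1.symm.trans hj1)
  have hgi : ∀ X t, stateMat d Φ X ⟨i, by omega⟩ t = φ X t := fun X t => by
    unfold stateMat
    rw [List.getD_eq_getElem _ _ hi, hi1]
  have hgj : ∀ X t, stateMat d Φ X ⟨j, by omega⟩ t = ψ X t := fun X t => by
    unfold stateMat
    rw [List.getD_eq_getElem _ _ hj, hj1]
  refine ⟨fun k => if (k : ℕ) = i ∨ (k : ℕ) = j then 1 else 0, fun k => indicator_mem h _,
    fun X t => ?_⟩
  rw [fsum_pair h (i := ⟨i, by omega⟩) (j := ⟨j, by omega⟩) (by simpa using hij)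
    (hΦ φ hφ X t) (hΦ ψ hψ X t), hr]
  · beta_reduce
    rw [if_pos (Or.inl rfl), hgi, fmul_one_left h (hΦ φ hφ X t)]
  · beta_reduce
    rw [if_pos (Or.inr rfl), hgj, fmul_one_left h (hΦ ψ hψ X t)]
  · intro k hki hkj
    beta_reduce
    rw [if_neg, fmul_zero_left h]
    rintro (e | e)
    · exact hki (Fin.ext e)
    · exact hkj (Fin.ext e)

end Features

end FPT


namespace FPT

section Gates

variable {p q : ℕ}

lemma neg_one_mem (h : WideRange p q) : (-1 : ℝ) ∈ Fset p q := neg_mem_Fset (one_mem h)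

lemma frelu_fin (h : WideRange p q) {y : ℝ} (hy : y ∈ Fset p q) :
    frelu p q (.fin y) = .fin (max y 0) := by
  simp only [frelu]
  refine rnd_self h ?_
  rcases max_choice y 0 with e | e <;> rw [e]
  · exact hy
  · exact h.zero_mem

lemma max_zero_mem (h : WideRange p q) {y : ℝ} (hy : y ∈ Fset p q) : max y 0 ∈ Fset p q := by
  rcases max_choice y 0 with e | e <;> rw [e]
  · exact hy
  · exact h.zero_mem

lemma two_zpow_le_sub {x y : ℝ} (hx : x ∈ Fset p q) (hy : y ∈ Fset p q) (hxy : x < y) :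
    (2 : ℝ) ^ (emin q - p) ≤ y - x := by
  obtain ⟨a, rfl⟩ := Fset_multiple hx
  obtain ⟨b, rfl⟩ := Fset_multiple hy
  have hpos := zpow_two_pos (emin q - p)
  have hab : a < b := by
    by_contra hc
    have : (b : ℝ) ≤ a := by exact_mod_cast not_lt.1 hc
    nlinarith
  have : (a : ℝ) + 1 ≤ b := by exact_mod_cast hab
  nlinarith

lemma tiny_mem (h : WideRange p q) : (2 : ℝ) ^ (emin q - p) ∈ Fset p q :=
  zpow_mem h.emin_le_emax le_rfl (by have := h.emin_le_emax; omega)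

lemma sign_mul_mem {s y : ℝ} (hs : s = 1 ∨ s = -1) (hy : y ∈ Fset p q) : s * y ∈ Fset p q := by
  rcases hs with rfl | rfl
  · rwa [one_mul]
  · rw [neg_one_mul]; exact neg_mem_Fset hy

/-- Thresholding gate: it vanishes exactly when `s * y ≤ s * a`. -/
lemma frelu_sign_sub (h : WideRange p q) {s y a : ℝ} (hs : s = 1 ∨ s = -1) (hy : y ∈ Fset p q)
    (ha : a ∈ Fset p q) (hy0 : 0 ≤ y) (ha0 : 0 ≤ a) :
    frelu p q (fadd p q (fmul p q (.fin s) (.fin y)) (.fin (-(s * a)))) =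
      .fin (max (rv p q (s * y - s * a)) 0) := by
  simp only [fmul]
  rw [rnd_self h (sign_mul_mem hs hy)]
  simp only [fadd, ← sub_eq_add_neg]
  rw [rnd_eq, frelu_fin h (rv_mem h _)]
  have h1 := abs_le_Omega hy
  have h2 := abs_le_Omega ha
  rw [abs_of_nonneg hy0] at h1
  rw [abs_of_nonneg ha0] at h2
  rw [abs_le]
  rcases hs with rfl | rfl <;> constructor <;> linarith

lemma max_rv_sub_eq_zero (h : WideRange p q) {x y : ℝ} (hx : x ∈ Fset p q) (hy : y ∈ Fset p q) :
    max (rv p q (x - y)) 0 = 0 ↔ x ≤ y := by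
  rw [max_eq_right_iff]
  constructor
  · intro hle
    by_contra hc
    have h1 := le_rv h (tiny_mem h) (two_zpow_le_sub hy hx (not_le.1 hc))
    linarith [zpow_two_pos (emin q - p)]
  · exact fun hle => rv_le h h.zero_mem (by linarith)

lemma one_sub_mem (h : WideRange p q) : (1 - (2 : ℝ) ^ (1 - (p : ℤ))) ∈ Fset p q := by
  have h1 := h.emin_le
  have h2 := h.add_le
  have h3 := h.two_le
  have : (1 - (2 : ℝ) ^ (1 - (p : ℤ))) = ((2 ^ p - 2 : ℤ) : ℝ) * (2 : ℝ) ^ (-(p : ℤ)) := by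
    rw [zpow_sub₀ two_ne_zero, zpow_neg]
    push_cast
    field_simp
    simp
  rw [this]
  refine mul_zpow_mem ?_ (by omega) (by omega)
  have h4 : (2 : ℤ) ^ 1 ≤ 2 ^ p := pow_le_pow_right₀ (by norm_num) (by omega)
  rw [abs_of_nonneg (by linarith), pow_succ]
  linarith

lemma zero_test_amplify (h : WideRange p q) {u : ℝ} (hu : u ∈ Fset p q) (hu0 : 0 ≤ u) :
    ∃ z ∈ Fset p q, frelu p q (fadd p q (fmul p q (.fin (-(2 : ℝ) ^ emax q)) (.fin u)) (.fin 1)) =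
      .fin z ∧ 0 ≤ z ∧ (u = 0 → z = 1) ∧ (u ≠ 0 → z ≤ 1 - (2 : ℝ) ^ (1 - (p : ℤ))) := by
  have hp2 : (2 : ℝ) ^ (1 - (p : ℤ)) ≤ 1 := by
    have := h.two_le
    simpa using zpow_two_le (show 1 - (p : ℤ) ≤ 0 by omega)
  rcases eq_or_ne u 0 with rfl | hne
  · refine ⟨1, one_mem h, ?_, zero_le_one, fun _ => rfl, fun hc => absurd rfl hc⟩
    rw [fmul_zero_right h, fadd_zero_left h (x := .fin 1) (one_mem h), frelu_fin h (one_mem h)]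
    simp
  · have hlow : (2 : ℝ) ^ (emin q - p) ≤ u := by
      simpa using two_zpow_le_sub h.zero_mem hu (lt_of_le_of_ne hu0 hne.symm)
    have hx : -(2 : ℝ) ^ emax q * u ≤ -(2 : ℝ) ^ (1 - (p : ℤ)) := by
      have e : (2 : ℝ) ^ (1 - (p : ℤ)) = (2 : ℝ) ^ emax q * (2 : ℝ) ^ (emin q - p) := by
        rw [← zpow_two_add, emin_eq]; congr 1; ring
      rw [e]
      nlinarith [zpow_two_pos (emax q)]
    have hxm : -(2 : ℝ) ^ (1 - (p : ℤ)) ∈ Fset p q := by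
      have h1 := h.emin_le
      have h2 := h.add_le
      have h3 := h.two_le
      exact neg_mem_Fset (zpow_mem h.emin_le_emax (by omega) (by omega))
    set x := -(2 : ℝ) ^ emax q * u with hxdef
    have hxneg : x ≤ 0 := hx.trans (by linarith [zpow_two_pos (1 - (p : ℤ))])
    have hthr : (0 : ℝ) < thr p q :=
      lt_of_lt_of_le (zpow_two_pos _) (zpow_emax_le_Omega.trans Omega_lt_thr.le)
    simp only [fmul]
    by_cases hov : x ≤ -thr p q
    · refine ⟨0, h.zero_mem, ?_, le_rfl, fun hc => absurd hc hne, fun _ => by linarith⟩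
      unfold rnd
      rw [if_neg (by linarith), if_pos hov]
      rfl
    · have hr : rnd p q x = .fin (rv p q x) := by
        unfold rnd
        rw [if_neg (by linarith), if_neg hov]
        rfl
      have hy : rv p q x ≤ -(2 : ℝ) ^ (1 - (p : ℤ)) := rv_le h hxm hx
      have hya := (abs_le.1 (abs_le_Omega (rv_mem h x))).1
      have h1Ω := (abs_le.1 (abs_le_Omega (one_mem h))).2
      have hpos := zpow_two_pos (1 - (p : ℤ))
      rw [hr]
      simp only [fadd]
      rw [rnd_eq (abs_le.2 ⟨by linarith, by linarith⟩), frelu_fin h (rv_mem h _)]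
      refine ⟨_, max_zero_mem h (rv_mem h _), rfl, le_max_right _ _, fun hc => absurd hc hne,
        fun _ => max_le (rv_le h (one_sub_mem h) (by linarith)) (by linarith)⟩

lemma zero_test_normalize (h : WideRange p q) {z : ℝ} (hz : z ∈ Fset p q) (hz0 : 0 ≤ z)
    (hz1 : z = 1 ∨ z ≤ 1 - (2 : ℝ) ^ (1 - (p : ℤ))) :
    frelu p q (fadd p q (fmul p q (.fin ((2 : ℝ) ^ (p - 1))) (.fin z))
      (.fin (1 - (2 : ℝ) ^ (p - 1)))) = .fin (if z = 1 then 1 else 0) := by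
  have hge : (1 : ℝ) ≤ 2 ^ (p - 1) := one_le_pow₀ (by norm_num)
  have hnat : ((2 ^ (p - 1) : ℕ) : ℝ) = (2 : ℝ) ^ (p - 1) := by push_cast; rfl
  have hnat' : ((2 ^ (p - 1) - 1 : ℕ) : ℝ) = (2 : ℝ) ^ (p - 1) - 1 := by
    rw [Nat.cast_sub Nat.one_le_two_pow]; push_cast; rfl
  have hle : 2 ^ (p - 1) ≤ 2 ^ (p + 1) := Nat.pow_le_pow_right (by norm_num) (by omega)
  have hm : (2 : ℝ) ^ (p - 1) ∈ Fset p q := hnat ▸ natCast_mem h hle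
  have hm' : (2 : ℝ) ^ (p - 1) - 1 ∈ Fset p q := hnat' ▸ natCast_mem h ((Nat.sub_le _ _).trans hle)
  have hΩ := (abs_le.1 (abs_le_Omega hm)).2
  have hpow : (2 : ℝ) ^ (p - 1) * (2 : ℝ) ^ (1 - (p : ℤ)) = 1 := by
    have h3 := h.two_le
    rw [← zpow_natCast, ← zpow_add₀ two_ne_zero]
    have : ((p - 1 : ℕ) : ℤ) + (1 - (p : ℤ)) = 0 := by omega
    rw [this, zpow_zero]
  by_cases h1 : z = 1
  · subst h1
    rw [if_pos rfl, fmul_one_right h hm]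
    simp only [fadd]
    rw [show (2 : ℝ) ^ (p - 1) + (1 - 2 ^ (p - 1)) = 1 by ring, rnd_self h (one_mem h),
      frelu_fin h (one_mem h)]
    simp
  · have hz1 := hz1.resolve_left h1
    rw [if_neg h1]
    have hprod : (2 : ℝ) ^ (p - 1) * z ≤ 2 ^ (p - 1) - 1 := by nlinarith
    have hprod0 : 0 ≤ (2 : ℝ) ^ (p - 1) * z := by positivity
    simp only [fmul]
    rw [rnd_eq (abs_le.2 ⟨by linarith, by linarith⟩)]
    have hr := rv_le h hm' hprod
    have hr0 := le_rv h h.zero_mem hprod0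
    simp only [fadd]
    rw [rnd_eq (abs_le.2 ⟨by linarith, by linarith⟩), frelu_fin h (rv_mem h _), max_eq_right]
    exact rv_le h h.zero_mem (by linarith)

end Gates

end FPT


namespace FPT

section Obtainable

variable {p q din n : ℕ}

/-- The rows of the input matrix as features. -/
def inputs (p q din n : ℕ) : List (Feature p q din n) :=
  List.ofFn fun (i : Fin din) X t => (X i t : ℝ)

/-- A list of features, containing the inputs, that a stack of transformer blocks computes from
the inputs in every sufficiently large hidden dimension. -/
def Realizable (Φ : List (Feature p q din n)) : Prop :=
  (∀ φ ∈ Φ, φ.IsFloat) ∧ inputs p q din n ⊆ Φ ∧ din ≤ Φ.length ∧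
    ∀ d, Φ.length ≤ d → ∃ L : List (Block 1 1 1 d), L ≠ [] ∧ (∀ B ∈ L, B.Valid p q) ∧
      ∀ X, blocksApply p q L (toEF (stateMat d (inputs p q din n) X)) = toEF (stateMat d Φ X)

/-- A feature that can be added to every realizable list of features. -/
def Obtainable (φ : Feature p q din n) : Prop :=
  ∀ Φ, Realizable Φ → ∃ Φ', Realizable Φ' ∧ Φ ⊆ Φ' ∧ φ ∈ Φ'

lemma inputs_isFloat : ∀ φ ∈ inputs p q din n, φ.IsFloat := by
  intro φ hφ X t
  obtain ⟨i, rfl⟩ := (List.mem_ofFn' _ _).1 hφ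
  exact (X i t).2

lemma input_mem (i : Fin din) : (fun X t => (X i t : ℝ)) ∈ inputs p q din n :=
  (List.mem_ofFn' _ _).2 ⟨i, rfl⟩

lemma isFloat_append {Φ : List (Feature p q din n)} {χ : Feature p q din n}
    (hΦ : ∀ φ ∈ Φ, φ.IsFloat) (hχ : χ.IsFloat) : ∀ φ ∈ Φ ++ [χ], φ.IsFloat := by
  intro φ hφ
  rcases List.mem_append.1 hφ with hφ | hφ
  · exact hΦ φ hφ
  · rw [List.mem_singleton.1 hφ]; exact hχ

lemma Realizable.append {Φ : List (Feature p q din n)} {χ : Feature p q din n}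
    (hΦ : Realizable Φ) (hχ : Appendable Φ χ) : Realizable (Φ ++ [χ]) := by
  obtain ⟨h1, h2, h3, h4⟩ := hΦ
  refine ⟨isFloat_append h1 hχ.1, fun φ hφ => List.mem_append_left _ (h2 hφ), by simp; omega,
    fun d hd => ?_⟩
  simp only [List.length_append, List.length_singleton] at hd
  obtain ⟨L, hL, hLv, hLa⟩ := h4 d (by omega)
  obtain ⟨B, hB, hBa⟩ := hχ.2 d hd
  refine ⟨L ++ [B], by simp, fun B' hB' => ?_, fun X => ?_⟩
  · rcases List.mem_append.1 hB' with hB' | hB'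
    · exact hLv _ hB'
    · rwa [List.mem_singleton.1 hB']
  · rw [← hBa X, ← hLa X]
    simp [blocksApply]

lemma Realizable.exists_superset {Φ : List (Feature p q din n)} (hΦ : Realizable Φ)
    (Ψ : List (Feature p q din n)) (hΨ : ∀ ψ ∈ Ψ, Obtainable ψ) :
    ∃ Φ', Realizable Φ' ∧ Φ ⊆ Φ' ∧ Ψ ⊆ Φ' := by
  induction Ψ with
  | nil => exact ⟨Φ, hΦ, List.Subset.refl _, List.nil_subset _⟩
  | cons ψ Ψ ih =>
    obtain ⟨Φ1, h1, h2, h3⟩ := ih fun φ hφ => hΨ φ (List.mem_cons_of_mem _ hφ)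
    obtain ⟨Φ2, h4, h5, h6⟩ := hΨ ψ List.mem_cons_self Φ1 h1
    exact ⟨Φ2, h4, List.Subset.trans h2 h5,
      List.cons_subset.2 ⟨h6, List.Subset.trans h3 h5⟩⟩

lemma Obtainable.of_appendable {χ : Feature p q din n} (Ψ : List (Feature p q din n))
    (hΨ : ∀ ψ ∈ Ψ, Obtainable ψ)
    (hχ : ∀ Φ : List (Feature p q din n), (∀ φ ∈ Φ, φ.IsFloat) → Ψ ⊆ Φ → Appendable Φ χ) :
    Obtainable χ := by
  intro Φ hΦ
  obtain ⟨Φ', h1, h2, h3⟩ := hΦ.exists_superset Ψ hΨ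
  exact ⟨Φ' ++ [χ], h1.append (hχ Φ' h1.1 h3), List.Subset.trans h2 (List.subset_append_left _ _),
    by simp⟩

lemma obtainable_input (i : Fin din) :
    Obtainable fun (X : FloatMat p q din n) t => (X i t : ℝ) :=
  fun Φ hΦ => ⟨Φ, hΦ, List.Subset.refl _, hΦ.2.1 (input_mem i)⟩

/-- Unary gates whose values are only specified pointwise. -/
lemma Obtainable.unary (h : WideRange p q) (hn : 0 < n) {φ : Feature p q din n} (hφ : Obtainable φ)
    {χ : Feature p q din n} {a b : ℝ} (ha : a ∈ Fset p q) (hb : b ∈ Fset p q) (hχ : χ.IsFloat)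
    (hr : φ.IsFloat → ∀ X t, frelu p q (fadd p q (fmul p q (.fin a) (.fin (φ X t))) (.fin b)) =
      .fin (χ X t)) : Obtainable χ :=
  .of_appendable [φ] (by simpa using hφ) fun Φ hΦ hsub =>
    have hmem : φ ∈ Φ := hsub (List.mem_singleton_self φ)
    appendable_unary h hn hΦ hmem hχ ha hb (hr (hΦ φ hmem))

/-- The indicator feature of a predicate. -/
noncomputable def bit (P : FloatMat p q din n → Fin n → Prop) : Feature p q din n :=
  fun X t => if P X t then 1 else 0


end Obtainable

end FPT


namespace FPT

section Predicates

variable {p q din n : ℕ}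

lemma bit_isFloat (h : WideRange p q) (P : FloatMat p q din n → Fin n → Prop) :
    (bit P).IsFloat := fun _ _ => indicator_mem h _

lemma appendable_one (h : WideRange p q) (hn : 0 < n) (hdin : 0 < din)
    {Φ : List (Feature p q din n)} (hΦ : ∀ φ ∈ Φ, φ.IsFloat) (hin : inputs p q din n ⊆ Φ) :
    Appendable Φ (bit fun _ _ => True) := by
  refine appendable_unary h hn hΦ (hin (input_mem ⟨0, hdin⟩)) (bit_isFloat h _) h.zero_mem
    (one_mem h) fun X t => ?_
  rw [fmul_zero_left h, fadd_zero_left h (x := .fin 1) (one_mem h), frelu_fin h (one_mem h)]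
  simp [bit]

lemma exists_realizable (h : WideRange p q) (hn : 0 < n) (hdin : 0 < din) :
    ∃ Φ : List (Feature p q din n), Realizable Φ := by
  have ha := appendable_one h hn hdin (Φ := inputs p q din n) inputs_isFloat
    (List.Subset.refl _)
  refine ⟨inputs p q din n ++ [bit fun _ _ => True], isFloat_append inputs_isFloat ha.1,
    List.subset_append_left _ _, by simp [inputs], fun d hd => ?_⟩
  obtain ⟨B, hB, hBa⟩ := ha.2 d (by simpa using hd)
  exact ⟨[B], by simp, by simpa using hB, fun X => by simpa [blocksApply] using hBa X⟩

lemma obtainable_true (h : WideRange p q) (hn : 0 < n) (hdin : 0 < din) :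
    Obtainable (bit fun (_ : FloatMat p q din n) (_ : Fin n) => True) :=
  fun Φ hΦ => ⟨_, hΦ.append (appendable_one h hn hdin hΦ.1 hΦ.2.1), List.subset_append_left _ _,
    by simp⟩

lemma Obtainable.and (h : WideRange p q) (hn : 0 < n) {P Q : FloatMat p q din n → Fin n → Prop}
    (hP : Obtainable (bit P)) (hQ : Obtainable (bit Q)) :
    Obtainable (bit fun X t => P X t ∧ Q X t) := by
  by_cases hPQ : bit P = bit Q
  · have : (bit fun X t => P X t ∧ Q X t) = bit P := by
      funext X t
      have h1 := congrFun (congrFun hPQ X) t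
      unfold bit at h1 ⊢
      by_cases h2 : P X t <;> by_cases h3 : Q X t <;> simp_all
    rwa [this]
  · refine .of_appendable [bit P, bit Q] (by simp [hP, hQ]) fun Φ hΦ hsub =>
      appendable_add h hn hΦ (hsub (by simp)) (hsub (by simp)) hPQ (bit_isFloat h _)
        (neg_one_mem h) fun X t => ?_
    have h2 : fadd p q (.fin 1) (.fin 1) = .fin 2 := by
      simp only [fadd, one_add_one_eq_two]; exact rnd_self h (two_mem h)
    have h1 : fadd p q (.fin 2) (.fin (-1)) = .fin 1 := by
      simp only [fadd]
      rw [show (2 : ℝ) + -1 = 1 by norm_num]; exact rnd_self h (one_mem h)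
    have h0 : fadd p q (.fin 1) (.fin (-1)) = .fin 0 := by
      simp only [fadd, add_neg_cancel]; exact rnd_self h h.zero_mem
    unfold bit
    by_cases hp : P X t <;> by_cases hq : Q X t <;>
      simp only [hp, hq, if_true, if_false, and_self, and_true, and_false]
    · rw [h2, h1, frelu_fin h (one_mem h)]; simp
    · rw [fadd_zero_right h (x := .fin 1) (one_mem h), h0, frelu_fin h h.zero_mem]; simp
    · rw [fadd_zero_left h (x := .fin 1) (one_mem h), h0, frelu_fin h h.zero_mem]; simp
    · rw [fadd_zero_left h (x := .fin 0) h.zero_mem,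
        fadd_zero_left h (x := .fin (-1)) (neg_one_mem h), frelu_fin h (neg_one_mem h)]
      simp

lemma Obtainable.forall (h : WideRange p q) (hn : 0 < n) (hdin : 0 < din) {ι : Type*}
    (s : Finset ι) {P : ι → FloatMat p q din n → Fin n → Prop}
    (hP : ∀ i ∈ s, Obtainable (bit (P i))) : Obtainable (bit fun X t => ∀ i ∈ s, P i X t) := by
  induction s using Finset.induction_on with
  | empty => simpa using obtainable_true h hn hdin
  | insert a s _ ih =>
    simp only [Finset.forall_mem_insert] at hP ⊢
    exact hP.1.and h hn (ih hP.2)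

lemma Obtainable.eq_zero (h : WideRange p q) (hn : 0 < n) {φ : Feature p q din n}
    (hφ : Obtainable φ) (hF : φ.IsFloat) (h0 : ∀ X t, 0 ≤ φ X t) :
    Obtainable (bit fun X t => φ X t = 0) := by
  have hex := fun X t => zero_test_amplify h (hF X t) (h0 X t)
  choose z hzF hz hz0 hz1 hz2 using hex
  have hzO : Obtainable z := hφ.unary h hn
    (neg_mem_Fset (zpow_mem h.emin_le_emax (by have := h.emin_le_emax; omega) le_rfl))
    (one_mem h) hzF fun _ => hz
  have hnat : ((2 ^ (p - 1) : ℕ) : ℝ) = (2 : ℝ) ^ (p - 1) := by push_cast; rfl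
  have hnat' : -((2 ^ (p - 1) - 1 : ℕ) : ℝ) = 1 - (2 : ℝ) ^ (p - 1) := by
    rw [Nat.cast_sub Nat.one_le_two_pow]; push_cast; ring
  have hle : 2 ^ (p - 1) ≤ 2 ^ (p + 1) := Nat.pow_le_pow_right (by norm_num) (by omega)
  refine hzO.unary h hn (a := (2 : ℝ) ^ (p - 1)) (b := 1 - (2 : ℝ) ^ (p - 1))
    (hnat ▸ natCast_mem h hle)
    (hnat' ▸ neg_mem_Fset (natCast_mem h ((Nat.sub_le _ _).trans hle))) (bit_isFloat h _)
    fun _ X t => ?_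
  have hlt : 1 - (2 : ℝ) ^ (1 - (p : ℤ)) < 1 := by linarith [zpow_two_pos (1 - (p : ℤ))]
  rw [zero_test_normalize h (hzF X t) (hz0 X t)]
  · unfold bit
    congr 1
    refine if_congr ⟨fun he => ?_, hz1 X t⟩ rfl rfl
    by_contra hne
    linarith [hz2 X t hne]
  · by_cases hc : φ X t = 0
    · exact Or.inl (hz1 X t hc)
    · exact Or.inr (hz2 X t hc)

lemma Obtainable.sign_le (h : WideRange p q) (hn : 0 < n) {φ : Feature p q din n}
    (hφ : Obtainable φ) (hF : φ.IsFloat) (h0 : ∀ X t, 0 ≤ φ X t) {a s : ℝ} (ha : a ∈ Fset p q)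
    (ha0 : 0 ≤ a) (hs : s = 1 ∨ s = -1) :
    Obtainable (bit fun X t => s * φ X t ≤ s * a) := by
  have hsF : s ∈ Fset p q := by
    rcases hs with rfl | rfl
    · exact one_mem h
    · exact neg_one_mem h
  have hu : Obtainable fun X t => max (rv p q (s * φ X t - s * a)) 0 :=
    hφ.unary h hn hsF (neg_mem_Fset (sign_mul_mem hs ha)) (fun _ _ => max_zero_mem h (rv_mem h _))
      fun _ X t => frelu_sign_sub h hs (hF X t) ha (h0 X t) ha0
  have := hu.eq_zero h hn (fun _ _ => max_zero_mem h (rv_mem h _)) fun _ _ => le_max_right _ _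
  convert this using 4 with X t
  exact (max_rv_sub_eq_zero h (sign_mul_mem hs (hF X t)) (sign_mul_mem hs ha)).symm

lemma Obtainable.eq_of_nonneg (h : WideRange p q) (hn : 0 < n) {φ : Feature p q din n}
    (hφ : Obtainable φ) (hF : φ.IsFloat) (h0 : ∀ X t, 0 ≤ φ X t) {a : ℝ} (ha : a ∈ Fset p q)
    (ha0 : 0 ≤ a) : Obtainable (bit fun X t => φ X t = a) := by
  have := (hφ.sign_le h hn hF h0 ha ha0 (Or.inl rfl)).and h hn
    (hφ.sign_le h hn hF h0 ha ha0 (Or.inr rfl))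
  convert this using 4 with X t
  constructor
  · rintro rfl; simp
  · rintro ⟨h1, h2⟩; linarith

lemma Obtainable.sign_part (h : WideRange p q) (hn : 0 < n) {φ : Feature p q din n}
    (hφ : Obtainable φ) (hF : φ.IsFloat) {s : ℝ} (hs : s = 1 ∨ s = -1) :
    Obtainable fun X t => max (s * φ X t) 0 := by
  have hsF : s ∈ Fset p q := by
    rcases hs with rfl | rfl
    · exact one_mem h
    · exact neg_one_mem h
  refine hφ.unary h hn hsF h.zero_mem (fun X t => max_zero_mem h (sign_mul_mem hs (hF X t)))
    fun _ X t => ?_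
  simp only [fmul]
  rw [rnd_self h (sign_mul_mem hs (hF X t)),
    fadd_zero_right h (x := .fin _) (sign_mul_mem hs (hF X t)),
    frelu_fin h (sign_mul_mem hs (hF X t))]

/-- Equality with a fixed float is decidable by transformer blocks. -/
lemma Obtainable.eq_const (h : WideRange p q) (hn : 0 < n) {φ : Feature p q din n}
    (hφ : Obtainable φ) (hF : φ.IsFloat) {a : ℝ} (ha : a ∈ Fset p q) :
    Obtainable (bit fun X t => φ X t = a) := by
  have key : ∀ s : ℝ, s = 1 ∨ s = -1 →
      Obtainable (bit fun X t => max (s * φ X t) 0 = max (s * a) 0) := fun s hs =>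
    (hφ.sign_part h hn hF hs).eq_of_nonneg h hn
      (fun X t => max_zero_mem h (sign_mul_mem hs (hF X t))) (fun _ _ => le_max_right _ _)
      (max_zero_mem h (sign_mul_mem hs ha)) (le_max_right _ _)
  have := (key 1 (Or.inl rfl)).and h hn (key (-1) (Or.inr rfl))
  convert this using 4 with X t
  constructor
  · intro e; simp [e]
  · rintro ⟨h1, h2⟩
    rw [one_mul, one_mul] at h1
    rw [neg_one_mul, neg_one_mul] at h2
    have e : ∀ x : ℝ, x = max x 0 - max (-x) 0 := fun x => by
      rcases le_total x 0 with hx | hx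
      · rw [max_eq_right hx, max_eq_left (by linarith)]; ring
      · rw [max_eq_left hx, max_eq_right (by linarith)]; ring
    rw [e (φ X t), e a, h1, h2]

end Predicates

end FPT


namespace FPT

section Counting

lemma eq_of_eq_counts {α : Type*} [Fintype α] {c c' : α → ℕ} {n T : ℕ} (g : ℕ → ℝ)
    (hg : Monotone g) (hgT : ∀ k < T, g k < g (k + 1)) (hn : n ≤ 2 * T) (hc : ∑ v, c v = n)
    (hc' : ∑ v, c' v = n) (hgc : ∀ v, g (c v) = g (c' v)) : c = c' := by
  have key : ∀ a b : ℕ, g a = g b → a < b → T ≤ a := by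
    intro a b hab hlt
    by_contra hT
    exact absurd hab ((hgT a (not_le.1 hT)).trans_le (hg hlt)).ne
  have hex : ∀ e e' : α → ℕ, ∑ v, e v = n → ∑ v, e' v = n → e ≠ e' → ∃ v, e v < e' v := by
    intro e e' he he' hne
    by_contra! hle
    obtain ⟨v, hv⟩ := Function.ne_iff.1 hne
    have := Finset.sum_lt_sum (s := Finset.univ) (fun v _ => hle v)
      ⟨v, Finset.mem_univ v, lt_of_le_of_ne (hle v) hv.symm⟩
    omega
  by_contra hne
  obtain ⟨u, hu⟩ := hex c c' hc hc' hne
  obtain ⟨v, hv⟩ := hex c' c hc' hc (Ne.symm hne)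
  have huv : u ≠ v := by rintro rfl; omega
  have h1 := key _ _ (hgc u) hu
  have h2 := key _ _ (hgc v).symm hv
  have h3 : ∑ x ∈ {u, v}, c x ≤ ∑ x, c x :=
    Finset.sum_le_sum_of_subset (Finset.subset_univ _)
  rw [Finset.sum_pair huv] at h3
  omega

/-- Two maps with equal fibre sizes agree up to a permutation that sends a given point to any
point with the same value. -/
lemma exists_perm_of_card_fiber_eq {α β : Type*} [Fintype α] {f f' : α → β} {a a' : α}
    (hcard : ∀ v, (Finset.univ.filter fun x => f x = v).card =
      (Finset.univ.filter fun x => f' x = v).card) (ha : f a = f' a') :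
    ∃ π : Equiv.Perm α, (∀ x, f (π x) = f' x) ∧ π a' = a := by
  have hE : ∀ v, Nonempty ({x // f' x = v} ≃ {x // f x = v}) := fun v =>
    ⟨Fintype.equivOfCardEq (by rw [Fintype.card_subtype, Fintype.card_subtype, hcard v])⟩
  let e : Equiv.Perm α := (Equiv.sigmaFiberEquiv f').symm.trans
    ((Equiv.sigmaCongrRight fun v => (hE v).some).trans (Equiv.sigmaFiberEquiv f))
  have he : ∀ x, f (e x) = f' x := fun x => ((hE (f' x)).some ⟨x, rfl⟩).2
  refine ⟨e.trans (Equiv.swap (e a') a), fun x => ?_, by simp⟩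
  rw [Equiv.trans_apply, ← he x]
  by_cases h1 : e x = e a'
  · rw [h1, Equiv.swap_apply_left, ha, he]
  · by_cases h2 : e x = a
    · rw [h2, Equiv.swap_apply_right, ha, he]
    · rw [Equiv.swap_apply_of_ne_of_ne h1 h2]

end Counting

section Keys

variable {p q din n : ℕ}

instance : Finite (Fset p q) := Fset_finite

lemma Obtainable.count (h : WideRange p q) (hn : 0 < n) {V w : ℝ} (hV : V ∈ Fset p q)
    (hw : w ∈ Fset p q) (hw0 : 0 ≤ w) (hw2 : w ≤ 2)
    (hVw : fmul p q (.fin V) (.fin (rv p q (1 / countSum p q 1 n))) = .fin w)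
    (hc : ∀ c ≤ n, countSum p q w c ≤ 2 ^ (p + 2)) {P : FloatMat p q din n → Fin n → Prop}
    (hP : Obtainable (bit P)) :
    Obtainable fun X _ => countSum p q w (Finset.univ.filter (P X)).card :=
  .of_appendable [bit P] (by simpa using hP) fun _ hΦ hsub =>
    appendable_count h hn hΦ hV hw hw0 hw2 hVw hc P (hsub (List.mem_singleton_self _))

/-- The `t`-th column of a matrix. -/
def column (X : FloatMat p q din n) (t : Fin n) : Fin din → Fset p q := fun i => X i t

/-- Number of occurrences of a given column. -/
noncomputable def multiplicity (X : FloatMat p q din n) (v : Fin din → Fset p q) : ℕ :=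
  (Finset.univ.filter fun t => column X t = v).card

/-- Two pointed matrices have the same marked column and the same rounded multiplicities. -/
def SameKey (w : ℝ) (y : FloatMat p q din n × Fin n) (X : FloatMat p q din n) (t : Fin n) : Prop :=
  column X t = column y.1 y.2 ∧
    ∀ v, countSum p q w (multiplicity X v) = countSum p q w (multiplicity y.1 v)

lemma obtainable_column_eq (h : WideRange p q) (hn : 0 < n) (hdin : 0 < din)
    (v : Fin din → Fset p q) :
    Obtainable (bit fun (X : FloatMat p q din n) t => column X t = v) := by
  have := Obtainable.forall h hn hdin Finset.univ
    (P := fun i (X : FloatMat p q din n) t => (X i t : ℝ) = v i)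
    fun i _ => (obtainable_input i).eq_const h hn (fun X t => (X i t).2) (v i).2
  convert this using 4 with X t
  simp [funext_iff, column, Subtype.ext_iff]

lemma obtainable_multiplicity (h : WideRange p q) (hn : 0 < n) (hdin : 0 < din) {V w : ℝ}
    (hV : V ∈ Fset p q) (hw : w ∈ Fset p q) (hw0 : 0 ≤ w) (hw2 : w ≤ 2)
    (hVw : fmul p q (.fin V) (.fin (rv p q (1 / countSum p q 1 n))) = .fin w)
    (hc : ∀ c ≤ n, countSum p q w c ≤ 2 ^ (p + 2)) (v : Fin din → Fset p q) :
    Obtainable fun (X : FloatMat p q din n) _ => countSum p q w (multiplicity X v) := by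
  convert (obtainable_column_eq h hn hdin v).count h hn hV hw hw0 hw2 hVw hc using 4
  unfold multiplicity
  congr

lemma obtainable_sameKey (h : WideRange p q) (hn : 0 < n) (hdin : 0 < din) {V w : ℝ}
    (hV : V ∈ Fset p q) (hw : w ∈ Fset p q) (hw0 : 0 ≤ w) (hw2 : w ≤ 2)
    (hVw : fmul p q (.fin V) (.fin (rv p q (1 / countSum p q 1 n))) = .fin w)
    (hc : ∀ c ≤ n, countSum p q w c ≤ 2 ^ (p + 2)) (y : FloatMat p q din n × Fin n) :
    Obtainable (bit (SameKey w y)) := by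
  have : Fintype (Fin din → Fset p q) := Fintype.ofFinite _
  have h1 := Obtainable.forall h hn hdin (Finset.univ : Finset (Fin din → Fset p q))
    (P := fun v X _ => countSum p q w (multiplicity X v) =
      countSum p q w (multiplicity y.1 v)) fun v _ =>
      (obtainable_multiplicity h hn hdin hV hw hw0 hw2 hVw hc v).eq_const h hn
        (fun _ _ => countSum_mem h _ _) (countSum_mem h _ _)
  have h2 := (obtainable_column_eq h hn hdin (column y.1 y.2)).and h hn h1
  convert h2 using 4 with X t
  simp [SameKey]

lemma SameKey.eq {w : ℝ} {y : FloatMat p q din n × Fin n} {X : FloatMat p q din n} {t : Fin n}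
    (hy : SameKey w y X t) : SameKey w y = SameKey w (X, t) := by
  funext X' t'
  simp only [SameKey, hy.1, hy.2]

lemma SameKey.exists_perm (h : WideRange p q) {w : ℝ} (hw0 : 0 ≤ w) {T : ℕ} (hT : n ≤ 2 * T)
    (hinj : ∀ c < T, countSum p q w c < countSum p q w (c + 1))
    {y : FloatMat p q din n × Fin n} {X : FloatMat p q din n} {t : Fin n}
    (hy : SameKey w y X t) :
    ∃ π : Equiv.Perm (Fin n), (∀ i u, X i (π u) = y.1 i u) ∧ π y.2 = t := by
  have : Fintype (Fin din → Fset p q) := Fintype.ofFinite _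
  have hsum : ∀ Z : FloatMat p q din n, ∑ v, multiplicity Z v = n := fun Z => by
    have := Finset.card_eq_sum_card_fiberwise (s := (Finset.univ : Finset (Fin n)))
      (t := (Finset.univ : Finset (Fin din → Fset p q))) (f := column Z) (by simp)
    rw [Finset.card_univ, Fintype.card_fin] at this
    refine Eq.trans ?_ this.symm
    refine Finset.sum_congr rfl fun v _ => ?_
    unfold multiplicity
    congr
  have hm := eq_of_eq_counts _ (countSum_monotone h hw0) hinj hT (hsum X) (hsum y.1) hy.2
  obtain ⟨π, h1, h2⟩ := exists_perm_of_card_fiber_eq (f := column X) (f' := column y.1)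
    (fun v => by
      have := congrFun hm v
      unfold multiplicity at this
      convert this) hy.1
  exact ⟨π, fun i u => congrFun (h1 u) i, h2⟩

end Keys

end FPT


namespace FPT

section Assembly

variable {p q din dout n : ℕ}

/-- A matrix of finite floats viewed as a matrix of extended floats. -/
def FloatMat.toMat (X : FloatMat p q din n) : Mat din n := toEF fun i t => (X i t : ℝ)

lemma EF.IsF.exists_eq {x : EF} (hx : x.IsF p q) : ∃ r ∈ Fset p q, x = .fin r := by
  cases x with
  | fin r => exact ⟨r, hx, rfl⟩
  | _ => exact hx.elim

lemma MatFin.exists_eq {X : Mat din n} (hX : MatFin p q X) :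
    ∃ Y : FloatMat p q din n, X = Y.toMat := by
  choose r hr hXr using fun i t => (hX i t).exists_eq
  exact ⟨fun i t => ⟨r i t, hr i t⟩, funext₂ hXr⟩

lemma FloatMat.matFin (X : FloatMat p q din n) : MatFin p q X.toMat := fun i t => (X i t).2

/-- The identity embedding places the input rows first and pads by zero. -/
lemma embed_eq_stateMat (h : WideRange p q) {d : ℕ} (X : FloatMat p q din n) :
    madd p q (mmul p q (toEF fun (i : Fin d) (j : Fin din) => if (i : ℕ) = j then (1 : ℝ) else 0)
      X.toMat) (fun _ _ => .fin 0) = toEF (stateMat d (inputs p q din n) X) := by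
  funext i t
  have hgoal : mmul p q (toEF fun (i : Fin d) (j : Fin din) => if (i : ℕ) = j then (1 : ℝ) else 0)
      X.toMat i t = .fin (stateMat d (inputs p q din n) X i t) := by
    unfold mmul toEF FloatMat.toMat toEF stateMat
    by_cases hi : (i : ℕ) < din
    · rw [fsum_single h ⟨i, hi⟩ (fmul_fin_valid h _ _)]
      · beta_reduce
        rw [if_pos rfl, fmul_one_left h (X _ t).2]
        simp [inputs, hi]
      · intro j hj
        beta_reduce
        rw [if_neg fun e : (i : ℕ) = j => hj (Fin.ext e.symm), fmul_zero_left h]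
    · rw [fsum_zero h fun j => by
        have : ¬ (i : ℕ) = j := fun e => hi (e ▸ j.2)
        beta_reduce
        rw [if_neg this, fmul_zero_left h]]
      have : (inputs p q din n)[(i : ℕ)]? = none := by simp [inputs]; omega
      simp [this]
  unfold madd
  rw [hgoal, fadd_zero_right h (x := .fin _) (stateMat_mem h inputs_isFloat X i t)]
  rfl

/-- If the rounded counts of a uniform attention head separate enough multiplicities, then every
permutation-equivariant function is represented by a transformer. -/
theorem exists_transformer_of_weight (h : WideRange p q) (hdin : 0 < din) (hn : 0 < n)
    {fstar : Mat din n → Mat dout n}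
    (hfin : ∀ X : Mat din n, MatFin p q X → MatFin p q (fstar X))
    (hequiv : ∀ (π : Equiv.Perm (Fin n)) (X : Mat din n), MatFin p q X →
      fstar (permCols π X) = permCols π (fstar X)) {V w : ℝ} {T : ℕ} (hV : V ∈ Fset p q)
    (hw : w ∈ Fset p q) (hw0 : 0 ≤ w) (hw2 : w ≤ 2)
    (hVw : fmul p q (.fin V) (.fin (rv p q (1 / countSum p q 1 n))) = .fin w) (hT : n ≤ 2 * T)
    (hinj : ∀ c < T, countSum p q w c < countSum p q w (c + 1))
    (hc : ∀ c ≤ n, countSum p q w c ≤ 2 ^ (p + 2)) :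
    ∃ f : Mat din n → Mat dout n, IsTransformer p q din dout n f ∧
      ∀ X : Mat din n, MatFin p q X → f X = fstar X := by
  have : Fintype (FloatMat p q din n × Fin n) := Fintype.ofFinite _
  choose val hvalF hval using fun (i : Fin dout) (y : FloatMat p q din n × Fin n) =>
    (hfin _ y.1.matFin i y.2).exists_eq
  have hvalKey : ∀ i y X t, SameKey w y X t → val i y = val i (X, t) := by
    intro i y X t hy
    obtain ⟨π, h1, h2⟩ := hy.exists_perm h hw0 hT hinj
    have hX : y.1.toMat = permCols π X.toMat := by
      funext j u
      simp only [FloatMat.toMat, toEF, permCols, h1]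
    have h3 : EF.fin (val i y) = .fin (val i (X, t)) := by
      rw [← hval, ← hval, hX, hequiv π _ X.matFin, permCols, h2]
    exact EF.fin.inj h3
  obtain ⟨Φ0, hΦ0⟩ := exists_realizable (din := din) h hn hdin
  obtain ⟨Φ, hΦ, -, hmem⟩ := hΦ0.exists_superset
    ((Finset.univ : Finset (FloatMat p q din n × Fin n)).toList.map fun y => bit (SameKey w y))
    (by
      simp only [List.mem_map, forall_exists_index, and_imp]
      rintro _ y - rfl
      exact obtainable_sameKey h hn hdin hV hw hw0 hw2 hVw hc y)
  have hmem' : ∀ y, bit (SameKey w y) ∈ Φ := fun y => hmem (by simp)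
  choose pos hpos using fun ψ : {ψ // ψ ∈ Φ} => List.mem_iff_get.1 ψ.2
  obtain ⟨-, -, hlen, hblocks⟩ := id hΦ
  obtain ⟨L, hL, hLv, hLa⟩ := hblocks Φ.length le_rfl
  let loc : FloatMat p q din n × Fin n → Fin Φ.length := fun y => pos ⟨_, hmem' y⟩
  have hloc : ∀ y X t, stateMat Φ.length Φ X (loc y) t = bit (SameKey w y) X t := by
    intro y X t
    unfold stateMat
    rw [List.getD_eq_getElem _ _ (loc y).2]
    exact congrFun (congrFun (hpos ⟨_, hmem' y⟩) X) t
  have hlocKey : ∀ y X t, SameKey w y X t → loc y = loc (X, t) := by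
    intro y X t hy
    have : (⟨_, hmem' y⟩ : {ψ // ψ ∈ Φ}) = ⟨_, hmem' (X, t)⟩ := Subtype.ext (congrArg bit hy.eq)
    exact congrArg pos this
  let Wout : Fin dout → Fin Φ.length → ℝ := fun i l =>
    if hl : ∃ y, loc y = l then val i hl.choose else 0
  have hWoutF : ∀ i l, Wout i l ∈ Fset p q := by
    intro i l
    simp only [Wout]
    split_ifs
    · exact hvalF _ _
    · exact h.zero_mem
  refine ⟨_, ⟨1, 1, 1, Φ.length, L, fun i j => if (i : ℕ) = j then 1 else 0, 0, Wout, 0, one_pos,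
    one_pos, one_pos, by omega, hL, hLv, fun i j => indicator_mem h _, fun _ => h.zero_mem, hWoutF,
    fun _ => h.zero_mem, fun X => rfl⟩, fun X hX => ?_⟩
  obtain ⟨Y, rfl⟩ := hX.exists_eq
  simp only [Pi.zero_apply]
  rw [embed_eq_stateMat h, hLa]
  funext i t
  have hself : SameKey w (Y, t) Y t := ⟨rfl, fun _ => rfl⟩
  have hstate : stateMat Φ.length Φ Y (loc (Y, t)) t = 1 := by
    rw [hloc]; exact if_pos hself
  have hW : Wout i (loc (Y, t)) = val i (Y, t) := by
    have hl : ∃ y, loc y = loc (Y, t) := ⟨_, rfl⟩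
    simp only [Wout]
    rw [dif_pos hl]
    refine hvalKey i _ Y t ?_
    have h1 := hloc hl.choose Y t
    rw [hl.choose_spec, hstate] at h1
    by_contra hne
    rw [bit, if_neg hne] at h1
    exact one_ne_zero h1
  have hsum : mmul p q (toEF Wout) (toEF (stateMat Φ.length Φ Y)) i t = .fin (val i (Y, t)) := by
    unfold mmul toEF
    rw [fsum_single h (loc (Y, t)) (fmul_fin_valid h _ _), hstate, hW, fmul_one_right h (hvalF _ _)]
    intro l hl
    by_cases hex : ∃ y, loc y = l
    · obtain ⟨y, rfl⟩ := hex
      have hne : ¬ SameKey w y Y t := fun hy => hl (hlocKey y Y t hy)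
      rw [hloc, bit, if_neg hne, fmul_zero_right h]
    · simp only [Wout]
      rw [dif_neg hex, fmul_zero_left h]
  unfold madd
  rw [hsum, fadd_zero_right h (x := .fin _) (hvalF _ _)]
  exact (hval i (Y, t)).symm

end Assembly

end FPT


/-- If `n ≤ 6·2^p − 2`, floating-point transformers can represent every
permutation-equivariant function `𝔽^{d_in×n} → 𝔽^{d_out×n}`. -/
theorem stmt2 (p q : ℕ) (hp : 2 ≤ p) (hpq : (p : ℤ) ≤ 2 ^ (q - 1) - 3)
    (din dout n : ℕ) (hdin : 0 < din) (hdout : 0 < dout) (hn0 : 0 < n)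
    (hn : n ≤ 6 * 2 ^ p - 2)
    (fstar : FPT.Mat din n → FPT.Mat dout n)
    (hfin : ∀ X : FPT.Mat din n, FPT.MatFin p q X → FPT.MatFin p q (fstar X))
    (hequiv : ∀ (π : Equiv.Perm (Fin n)) (X : FPT.Mat din n), FPT.MatFin p q X →
      fstar (FPT.permCols π X) = FPT.permCols π (fstar X)) :
    ∃ f : FPT.Mat din n → FPT.Mat dout n,
      FPT.IsTransformer p q din dout n f ∧
        ∀ X : FPT.Mat din n, FPT.MatFin p q X → f X = fstar X := by
  have h : FPT.WideRange p q := ⟨hp, by unfold FPT.emax; omega⟩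
  obtain ⟨V, hV, w, hw, T, hw0, hw2, hVw, hT, hinj, hc⟩ :=
    FPT.exists_counting_weight h hn0 hn
  exact FPT.exists_transformer_of_weight h hdin hn0 hfin hequiv hV hw hw0 hw2 hVw hT hinj hc
end

section
/- For any x ∈ 𝔽̄ and any n, m ∈ ℕ∪{0}, the left-associative sums satisfy ⊕_{i=1}^{3·2^p−1+n} x = ⊕_{i=1}^{3·2^p−1+m} x. Furthermore, ⊕_{i=1}^{3·2^p−1} x lies in {0, +∞, −∞, NaN} ∪ ({±2^e : e ∈ ℤ} ∩ 𝔽). -/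
open scoped Classical

namespace FPT

/-- Integers `m * 2 ^ j` with `|m| < 2 ^ (p + 1)` and `j ≤ J`: the floats measured in units of the
smallest positive subnormal number, `J` being the width of the exponent range. -/
def IsFloatInt (p J : ℕ) (y : ℤ) : Prop :=
  ∃ (m : ℤ) (j : ℕ), |m| < 2 ^ (p + 1) ∧ j ≤ J ∧ y = m * 2 ^ j

/-- The integer float `y` has an even mantissa. -/
def IsEvenFloatInt (p J : ℕ) (y : ℤ) : Prop :=
  ∃ (m : ℤ) (j : ℕ), |m| < 2 ^ (p + 1) ∧ j ≤ J ∧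
    ((2 : ℤ) ^ p ≤ |m| ∨ j = 0) ∧ y = m * 2 ^ j ∧ 2 ∣ m

/-- Round to nearest, ties to even, in units of the smallest positive subnormal number. -/
def RoundsToInt (p J : ℕ) (t y : ℤ) : Prop :=
  IsFloatInt p J y ∧ (∀ z, IsFloatInt p J z → |t - y| ≤ |t - z|) ∧
    ((∀ z, IsFloatInt p J z → |t - z| = |t - y| → z = y) ∨ IsEvenFloatInt p J y)

/-- One addition of `N`, where `⊤` stands for overflow. -/
def AddStep (p J : ℕ) (N : ℤ) (A B : WithTop ℤ) : Prop :=
  (A = ⊤ → B = ⊤) ∧ ∀ s : ℤ, A = s →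
    ((2 : ℤ) ^ (p + J + 2) - 2 ^ J ≤ 2 * (s + N) ∧ B = ⊤) ∨
    (2 * (s + N) < (2 : ℤ) ^ (p + J + 2) - 2 ^ J ∧ ∃ y : ℤ, B = y ∧ RoundsToInt p J (s + N) y)

variable {p J : ℕ}

lemma IsFloatInt.abs_lt {y : ℤ} (h : IsFloatInt p J y) : |y| < 2 ^ (p + 1 + J) := by
  obtain ⟨m, j, hm, hj, rfl⟩ := h
  rw [abs_mul, abs_of_pos (by positivity : (0 : ℤ) < 2 ^ j), pow_add]
  have : (2 : ℤ) ^ j ≤ 2 ^ J := pow_le_pow_right₀ (by norm_num) hj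
  exact mul_lt_mul hm this (by positivity) (by positivity)

lemma IsFloatInt.neg {y : ℤ} (h : IsFloatInt p J y) : IsFloatInt p J (-y) := by
  obtain ⟨m, j, hm, hj, rfl⟩ := h
  exact ⟨-m, j, by rwa [abs_neg], hj, by ring⟩

lemma IsEvenFloatInt.neg {y : ℤ} (h : IsEvenFloatInt p J y) : IsEvenFloatInt p J (-y) := by
  obtain ⟨m, j, hm, hj, hn, rfl, h2⟩ := h
  exact ⟨-m, j, by rwa [abs_neg], hj, by rwa [abs_neg], by ring, h2.neg_right⟩

lemma RoundsToInt.neg {t y : ℤ} (h : RoundsToInt p J t y) : RoundsToInt p J (-t) (-y) := by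
  obtain ⟨h1, h2, h3⟩ := h
  have e : ∀ z : ℤ, |-t - z| = |t - -z| := fun z => by rw [← abs_neg]; congr 1; ring
  refine ⟨h1.neg, fun z hz => ?_, h3.imp (fun h z hz hh => ?_) IsEvenFloatInt.neg⟩
  · rw [e, e, neg_neg]; exact h2 _ hz.neg
  · rw [e, e, neg_neg] at hh
    rw [← h _ hz.neg hh, neg_neg]

lemma isFloatInt_zero : IsFloatInt p J 0 := ⟨0, 0, by simp, by simp, by simp⟩

/-- Large floats are divisible by large powers of two. -/
lemma IsFloatInt.pow_dvd {y : ℤ} (h : IsFloatInt p J y) {c : ℕ} (hc : 2 ^ (p + c) ≤ y) :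
    2 ^ c ∣ y := by
  obtain ⟨m, j, hm, hj, rfl⟩ := h
  have h1 : (2 : ℤ) ^ (p + c) < 2 ^ (p + 1 + j) := by
    rw [pow_add 2 (p + 1)]
    exact hc.trans_lt (mul_lt_mul_of_pos_right ((le_abs_self m).trans_lt hm) (by positivity))
  have h2 := (pow_lt_pow_iff_right₀ (by norm_num : (1 : ℤ) < 2)).1 h1
  exact (pow_dvd_pow 2 (by omega)).mul_left m

/-- An integer with at most `p + 1` significant bits is a float unless it overflows. -/
lemma isFloatInt_or_le {z : ℤ} {c : ℕ} (h0 : 0 ≤ z) (hd : 2 ^ c ∣ z) (hz : z ≤ 2 ^ (p + 1 + c)) :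
    IsFloatInt p J z ∨ 2 ^ (p + 1 + J) ≤ z := by
  obtain ⟨m, rfl⟩ := hd
  have hc : (0 : ℤ) < 2 ^ c := by positivity
  have hm0 : 0 ≤ m := nonneg_of_mul_nonneg_right h0 hc
  have hm1 : m ≤ 2 ^ (p + 1) := by
    rw [pow_add 2 (p + 1), mul_comm] at hz
    exact le_of_mul_le_mul_right hz hc
  rcases le_or_gt J c with h | h
  · obtain ⟨d, rfl⟩ := Nat.exists_eq_add_of_le h
    rcases lt_or_ge (2 ^ d * m) (2 ^ (p + 1)) with h1 | h1
    · exact .inl ⟨2 ^ d * m, J, by rwa [abs_of_nonneg (by positivity)], le_rfl, by ring⟩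
    · right
      have := mul_le_mul_of_nonneg_left h1 (by positivity : (0 : ℤ) ≤ 2 ^ J)
      calc (2 : ℤ) ^ (p + 1 + J) = 2 ^ J * 2 ^ (p + 1) := by ring
        _ ≤ _ := this
        _ = _ := by ring
  · left
    rcases hm1.lt_or_eq with h1 | rfl
    · exact ⟨m, c, by rwa [abs_of_nonneg hm0], h.le, by ring⟩
    · refine ⟨2 ^ p, c + 1, ?_, h, by ring⟩
      rw [abs_of_pos (by positivity)]
      exact pow_lt_pow_right₀ (by norm_num) (by omega)

/-- If `t` does not overflow and rounds below `z`, then it lies below the midpoint. -/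
lemma RoundsToInt.le_of_lt {t y z : ℤ} {c : ℕ} (h : RoundsToInt p J t y)
    (ht : 2 * t < (2 : ℤ) ^ (p + J + 2) - 2 ^ J)
    (h0 : 0 ≤ z) (hd : 2 ^ c ∣ z) (hz : z ≤ 2 ^ (p + 1 + c)) (hyz : y < z) : 2 * t ≤ y + z := by
  have key : ∀ z, IsFloatInt p J z → y < z → 2 * t ≤ y + z := fun z hF hyz => by
    have := h.2.1 z hF
    rcases abs_cases (t - y) with h1 | h1 <;> rcases abs_cases (t - z) with h2 | h2 <;> omega
  rcases isFloatInt_or_le (J := J) h0 hd hz with hF | hF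
  · exact key z hF hyz
  · have e1 : (2 : ℤ) ^ (p + J + 2) = 2 * 2 ^ (p + 1 + J) := by ring
    have e2 : (2 : ℤ) ^ (p + 1 + J) = 2 * (2 ^ p * 2 ^ J) := by ring
    have hJ : (0 : ℤ) < 2 ^ J := by positivity
    have hp1 : (1 : ℤ) ≤ 2 ^ p := one_le_pow₀ (by norm_num)
    have hO : IsFloatInt p J (2 ^ (p + 1 + J) - 2 ^ J) := by
      refine ⟨2 ^ (p + 1) - 1, J, ?_, le_rfl, by ring⟩
      have : (2 : ℤ) ^ (p + 1) = 2 * 2 ^ p := by ring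
      rw [abs_of_nonneg] <;> linarith
    rcases lt_or_ge y (2 ^ (p + 1 + J) - 2 ^ J) with h1 | h1
    · have := key _ hO h1
      linarith
    · linarith

lemma RoundsToInt.le_of_le {t y z : ℤ} {c : ℕ} (h : RoundsToInt p J t y)
    (ht : 2 * t < (2 : ℤ) ^ (p + J + 2) - 2 ^ J)
    (h0 : 0 ≤ z) (hd : 2 ^ c ∣ z) (hz : z ≤ 2 ^ (p + 1 + c)) (htz : z ≤ t) : z ≤ y := by
  by_contra hy
  have := h.le_of_lt ht h0 hd hz (not_le.1 hy)
  omega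

/-- Above the midpoint of `w` and `w + 2 ^ c`, one rounds up. -/
lemma RoundsToInt.add_pow_le {t y w : ℤ} {c : ℕ} (h : RoundsToInt p J t y)
    (ht : 2 * t < (2 : ℤ) ^ (p + J + 2) - 2 ^ J)
    (hw : 2 ^ (p + c) ≤ w) (hd : 2 ^ c ∣ w) (hz : w + 2 ^ c ≤ 2 ^ (p + 1 + c))
    (htw : 2 * w + 2 ^ c < 2 * t) : w + 2 ^ c ≤ y := by
  by_contra hy
  have hc : (0 : ℤ) < 2 ^ c := by positivity
  have hpc : (0 : ℤ) < 2 ^ (p + c) := by positivity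
  have h1 := h.le_of_lt ht (by linarith) (hd.add dvd_rfl) hz (not_le.1 hy)
  have h2 := h.le_of_le ht (by linarith) hd (by linarith) (by linarith)
  obtain ⟨d, hd'⟩ := (h.1.pow_dvd (hw.trans h2)).sub hd
  have h3 : 2 ^ c * d < 2 ^ c * 1 := by linarith
  have h4 := lt_of_mul_lt_mul_left h3 hc.le
  have h5 : 2 ^ c * d ≤ 2 ^ c * 0 := mul_le_mul_of_nonneg_left (by omega) hc.le
  linarith

/-- Up to half an ulp above a power of two, one rounds down to it. -/
lemma RoundsToInt.le_pow {t y : ℤ} {c : ℕ} (hp : 1 ≤ p) (h : RoundsToInt p J t y)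
    (ht : 2 * t ≤ 2 * 2 ^ (p + c) + 2 ^ c) : y ≤ 2 ^ (p + c) := by
  by_contra! hy
  have hc : (0 : ℤ) < 2 ^ c := by positivity
  have hpc : (0 : ℤ) < 2 ^ (p + c) := by positivity
  have hd : (2 : ℤ) ^ c ∣ 2 ^ (p + c) := pow_dvd_pow 2 (by omega)
  have hzF : IsFloatInt p J (2 ^ (p + c)) := by
    rcases isFloatInt_or_le (p := p) (J := J) (c := c) hpc.le hd
      (pow_le_pow_right₀ (by norm_num) (by omega)) with h1 | h1
    · exact h1
    · have := (le_abs_self y).trans_lt h.1.abs_lt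
      linarith
  have hmin := h.2.1 _ hzF
  obtain ⟨d, hd'⟩ := (h.1.pow_dvd hy.le).sub hd
  have h3 : 2 ^ c * 0 < 2 ^ c * d := by linarith
  have h4 := lt_of_mul_lt_mul_left h3 hc.le
  have h5 : 2 ^ c * 1 ≤ 2 ^ c * d := mul_le_mul_of_nonneg_left (by omega) hc.le
  have h6 : y + 2 ^ (p + c) ≤ 2 * t := by
    rcases abs_cases (t - y) with h1 | h1 <;>
      rcases abs_cases (t - 2 ^ (p + c)) with h2 | h2 <;> linarith
  have h7 : y = 2 ^ (p + c) + 2 ^ c := by linarith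
  rcases h.2.2 with hu | ⟨m, j, hm, hj, -, hy', k, rfl⟩
  · have := hu _ hzF (by
      rw [abs_of_nonneg (by linarith), abs_of_nonpos (by linarith)]
      linarith)
    linarith
  · have hk : k < 2 ^ p := by
      have := (le_abs_self _).trans_lt hm
      have e1 : (2 : ℤ) ^ (p + 1) = 2 * 2 ^ p := by ring
      linarith
    rw [h7] at hy'
    rcases lt_or_ge j c with hjc | hjc
    · obtain ⟨i, rfl⟩ := Nat.exists_eq_add_of_lt hjc
      have h8 : k = (2 ^ p + 1) * 2 ^ i :=
        mul_left_cancel₀ (by positivity : (2 : ℤ) ^ (j + 1) ≠ 0)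
          (by linear_combination -hy')
      have h9 : (1 : ℤ) ≤ 2 ^ i := one_le_pow₀ (by norm_num)
      have h10 : (0 : ℤ) < 2 ^ p := by positivity
      have h11 : (2 ^ p + 1) * 1 ≤ (2 ^ p + 1) * (2 : ℤ) ^ i :=
        mul_le_mul_of_nonneg_left h9 (by positivity)
      linarith
    · obtain ⟨i, rfl⟩ := Nat.exists_eq_add_of_le hjc
      have h8 : 2 * (k * 2 ^ i) = 2 ^ p + 1 :=
        mul_left_cancel₀ hc.ne' (by linear_combination -hy')
      obtain ⟨r, rfl⟩ := Nat.exists_eq_add_of_le hp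
      have : (2 : ℤ) ^ (1 + r) = 2 * 2 ^ r := by ring
      omega

lemma IsFloatInt.roundsToInt_self {y : ℤ} (h : IsFloatInt p J y) : RoundsToInt p J y y := by
  refine ⟨h, fun z _ => by simp, .inl fun z _ hz => ?_⟩
  rw [sub_self, abs_zero, abs_eq_zero] at hz
  omega

/-- Every nonnegative integer below the overflow threshold can be rounded. -/
lemma exists_roundsToInt {T : ℤ} (hp : 1 ≤ p) (hT0 : 0 ≤ T)
    (hT : 2 * T < (2 : ℤ) ^ (p + J + 2) - 2 ^ J) : ∃ y, RoundsToInt p J T y := by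
  rcases lt_or_ge T (2 ^ (p + 1)) with hs | hs
  · exact ⟨T, IsFloatInt.roundsToInt_self
      ⟨T, 0, by rwa [abs_of_nonneg hT0], by omega, by simp⟩⟩
  obtain ⟨j, hj1, hj2⟩ : ∃ j : ℕ, 2 ^ (p + j) ≤ T ∧ T < 2 ^ (p + 1 + j) := by
    lift T to ℕ using hT0
    have hs' : 2 ^ (p + 1) ≤ T := by exact_mod_cast hs
    have hT1 : T ≠ 0 := by have := Nat.one_le_two_pow (n := p + 1); omega
    have h1 : p + 1 ≤ Nat.log 2 T := Nat.le_log_of_pow_le (by norm_num) hs'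
    obtain ⟨j, hj⟩ := Nat.exists_eq_add_of_le (by omega : p ≤ Nat.log 2 T)
    refine ⟨j, ?_, ?_⟩
    · rw [← hj]; exact_mod_cast Nat.pow_log_le_self 2 hT1
    · rw [show p + 1 + j = Nat.log 2 T + 1 by omega]
      exact_mod_cast Nat.lt_pow_succ_log_self (by norm_num) T
  have hc : (0 : ℤ) < 2 ^ j := by positivity
  have hJ0 : (0 : ℤ) < 2 ^ J := by positivity
  have hjJ : j ≤ J := by
    have e1 : (2 : ℤ) ^ (p + j + 1) = 2 * 2 ^ (p + j) := by ring
    have h1 : (2 : ℤ) ^ (p + j + 1) < 2 ^ (p + J + 2) := by linarith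
    have := (pow_lt_pow_iff_right₀ (by norm_num : (1 : ℤ) < 2)).1 h1
    omega
  obtain ⟨m, hm0, hm1, hhalf, htie⟩ : ∃ m : ℤ, 2 ^ p ≤ m ∧ m ≤ 2 ^ (p + 1) ∧
      2 * |T - m * 2 ^ j| ≤ 2 ^ j ∧ (2 * |T - m * 2 ^ j| = 2 ^ j → 2 ∣ m) := by
    have hdiv := Int.mul_ediv_add_emod T (2 ^ j)
    have hr0 := Int.emod_nonneg T hc.ne'
    have hr1 := Int.emod_lt_of_pos T hc
    have hq0 : 2 ^ p ≤ T / 2 ^ j := by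
      rw [Int.le_ediv_iff_mul_le hc, ← pow_add]; exact hj1
    have hq1 : T / 2 ^ j < 2 ^ (p + 1) := by
      rw [Int.ediv_lt_iff_lt_mul hc, ← pow_add]; exact hj2
    generalize T / 2 ^ j = m at *
    generalize T % 2 ^ j = r at *
    have a1 : |T - m * 2 ^ j| = r := by
      rw [abs_of_nonneg] <;> linarith
    have a2 : |T - (m + 1) * 2 ^ j| = 2 ^ j - r := by
      rw [abs_of_nonpos] <;> linarith
    by_cases hup : 2 * r < 2 ^ j ∨ 2 * r = 2 ^ j ∧ 2 ∣ m
    · refine ⟨m, hq0, hq1.le, ?_, ?_⟩ <;> rw [a1]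
      · rcases hup with h | h <;> linarith
      · intro h
        rcases hup with h' | h'
        · linarith
        · exact h'.2
    · push Not at hup
      refine ⟨m + 1, by linarith, hq1, ?_, ?_⟩ <;> rw [a2]
      · linarith [hup.1]
      · intro h
        have := hup.2 (by linarith)
        omega
  have hdist : ∀ k : ℤ, k ≠ m → 2 ^ j - |T - m * 2 ^ j| ≤ |T - k * 2 ^ j| := by
    intro k hk
    have h1 : (2 : ℤ) ^ j ≤ |m * 2 ^ j - k * 2 ^ j| := by
      rw [← sub_mul, abs_mul, abs_of_pos hc]
      exact le_mul_of_one_le_left hc.le (Int.one_le_abs (sub_ne_zero.2 hk.symm))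
    have h2 := abs_sub_le (m * 2 ^ j) T (k * 2 ^ j)
    rw [abs_sub_comm (m * 2 ^ j) T] at h2
    linarith
  have hnear : ∀ k : ℤ, |T - m * 2 ^ j| ≤ |T - k * 2 ^ j| := by
    intro k
    rcases eq_or_ne k m with rfl | hk
    · exact le_rfl
    · linarith [hdist k hk]
  have hfar : ∀ z, IsFloatInt p J z → ¬ 2 ^ j ∣ z → |T - m * 2 ^ j| < |T - z| := by
    intro z hz hd
    have h1 : z < 2 ^ (p + j) := lt_of_not_ge fun h => hd (hz.pow_dvd h)
    have h2 := hnear (2 ^ p)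
    rw [← pow_add, abs_of_nonneg (sub_nonneg.2 hj1)] at h2
    have h3 := le_abs_self (T - z)
    linarith
  have heven : 2 ∣ m → IsEvenFloatInt p J (m * 2 ^ j) ∨ m = 2 ^ (p + 1) := fun h => by
    have hp0 : (0 : ℤ) < 2 ^ p := by positivity
    rcases hm1.lt_or_eq with h1 | h1
    · have : |m| = m := abs_of_nonneg (by linarith)
      exact .inl ⟨m, j, by rwa [this], hjJ, .inl (by rwa [this]), rfl, h⟩
    · exact .inr h1
  have htop : m = 2 ^ (p + 1) → IsEvenFloatInt p J (m * 2 ^ j) := by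
    rintro rfl
    have hjJ' : j < J := by
      refine lt_of_le_of_ne hjJ ?_
      rintro rfl
      have h1 := (abs_le.1 (show |T - 2 ^ (p + 1) * 2 ^ j| ≤ _ from le_rfl)).1
      have e1 : (2 : ℤ) ^ (p + j + 2) = 2 * (2 ^ (p + 1) * 2 ^ j) := by ring
      linarith
    have : |(2 : ℤ) ^ p| = 2 ^ p := abs_of_nonneg (by positivity)
    refine ⟨2 ^ p, j + 1, ?_, hjJ', .inl this.ge, by ring, dvd_pow_self 2 (by omega)⟩
    rw [this]
    exact pow_lt_pow_right₀ (by norm_num) (by omega)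
  refine ⟨m * 2 ^ j, ?_, ?_, ?_⟩
  · rcases hm1.lt_or_eq with h1 | h1
    · exact ⟨m, j, by rwa [abs_of_nonneg (le_trans (by positivity) hm0)], hjJ, rfl⟩
    · obtain ⟨m', j', h1, h2, -, h3, -⟩ := htop h1
      exact ⟨m', j', h1, h2, h3⟩
  · intro z hz
    by_cases hd : 2 ^ j ∣ z
    · obtain ⟨k, rfl⟩ := hd
      rw [mul_comm (2 ^ j) k]
      exact hnear k
    · exact (hfar z hz hd).le
  · by_cases ht : 2 * |T - m * 2 ^ j| = 2 ^ j
    · exact .inr ((heven (htie ht)).elim id htop)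
    · refine .inl fun z hz hzy => ?_
      by_cases hd : 2 ^ j ∣ z
      · obtain ⟨k, rfl⟩ := hd
        rw [mul_comm (2 ^ j) k] at hzy ⊢
        by_contra hk
        have := hdist k (fun h => hk (by rw [h]))
        exact ht (by linarith)
      · exact absurd hzy (hfar z hz hd).ne'

section Step

variable {N : ℤ} {A B : WithTop ℤ}

lemma AddStep.le_of_le (h : AddStep p J N A B) {v z : ℤ} (c : ℕ) (hA : (v : WithTop ℤ) ≤ A)
    (h0 : 0 ≤ z) (hd : 2 ^ c ∣ z) (hz : z ≤ 2 ^ (p + 1 + c)) (hzv : z ≤ v + N) :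
    (z : WithTop ℤ) ≤ B := by
  cases A with
  | top => rw [h.1 rfl]; exact le_top
  | coe s =>
    rcases h.2 s rfl with ⟨-, rfl⟩ | ⟨ht, y, rfl, hy⟩
    · exact le_top
    · have hvs := WithTop.coe_le_coe.1 hA
      exact WithTop.coe_le_coe.2 (hy.le_of_le ht h0 hd hz (by linarith))

lemma AddStep.add_pow_le (h : AddStep p J N A B) {v w : ℤ} (c : ℕ) (hA : (v : WithTop ℤ) ≤ A)
    (hw : 2 ^ (p + c) ≤ w) (hd : 2 ^ c ∣ w) (hz : w + 2 ^ c ≤ 2 ^ (p + 1 + c))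
    (htw : 2 * w + 2 ^ c < 2 * (v + N)) : ((w + 2 ^ c : ℤ) : WithTop ℤ) ≤ B := by
  cases A with
  | top => rw [h.1 rfl]; exact le_top
  | coe s =>
    rcases h.2 s rfl with ⟨-, rfl⟩ | ⟨ht, y, rfl, hy⟩
    · exact le_top
    · have hvs := WithTop.coe_le_coe.1 hA
      exact WithTop.coe_le_coe.2 (hy.add_pow_le ht hw hd hz (by linarith))

lemma AddStep.le_pow (hp : 1 ≤ p) (h : AddStep p J N A B) {c : ℕ}
    (hA : A = ⊤ ∨ A ≤ ((2 ^ (p + c) : ℤ) : WithTop ℤ)) (hN : 2 * N ≤ 2 ^ c) :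
    B = ⊤ ∨ B ≤ ((2 ^ (p + c) : ℤ) : WithTop ℤ) := by
  cases A with
  | top => exact .inl (h.1 rfl)
  | coe s =>
    rcases h.2 s rfl with ⟨-, rfl⟩ | ⟨ht, y, rfl, hy⟩
    · exact .inl rfl
    · rcases hA with hA | hA
      · exact absurd hA (WithTop.coe_ne_top)
      · have hvs := WithTop.coe_le_coe.1 hA
        exact .inr (WithTop.coe_le_coe.2 (hy.le_pow hp (by linarith)))

end Step

section Seq

variable {N : ℤ} {σ : ℕ → WithTop ℤ}

/-- Repeated sums of a number `N ≤ 2 ^ (c - 1)` that reach `2 ^ (p + c)` stay there, unless they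
overflow. -/
lemma stable_of_le (hp : 1 ≤ p) (hσ : ∀ k ≥ 1, AddStep p J N (σ k) (σ (k + 1)))
    (hF : ∀ k ≥ 1, ∀ y : ℤ, σ k = y → IsFloatInt p J y) {c K : ℕ} (hK : 1 ≤ K)
    (hN0 : 0 ≤ N) (hN : 2 * N ≤ 2 ^ c) (h1 : σ 1 ≤ ((2 ^ (p + c) : ℤ) : WithTop ℤ))
    (hlow : ((2 ^ (p + c) : ℤ) : WithTop ℤ) ≤ σ K) :
    (∀ n, σ (K + n) = ⊤) ∨
      ∃ b : ℕ, IsFloatInt p J (2 ^ b) ∧ ∀ n, σ (K + n) = ((2 ^ b : ℤ) : WithTop ℤ) := by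
  have hup : ∀ k ≥ 1, σ k = ⊤ ∨ σ k ≤ ((2 ^ (p + c) : ℤ) : WithTop ℤ) := by
    intro k hk
    induction k, hk using Nat.le_induction with
    | base => exact .inr h1
    | succ k hk ih => exact (hσ k hk).le_pow hp ih hN
  have hge : ∀ n, ((2 ^ (p + c) : ℤ) : WithTop ℤ) ≤ σ (K + n) := by
    intro n
    induction n with
    | zero => exact hlow
    | succ n ih =>
      exact (hσ (K + n) (by omega)).le_of_le c ih (by positivity) (pow_dvd_pow 2 (by omega))
        (pow_le_pow_right₀ (by norm_num) (by omega)) (by linarith)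
  rcases hup K hK with h | h
  · left
    intro n
    induction n with
    | zero => exact h
    | succ n ih => exact (hσ (K + n) (by omega)).1 ih
  · right
    have hz := hF K hK _ (le_antisymm h hlow)
    refine ⟨p + c, hz, fun n => ?_⟩
    induction n with
    | zero => exact le_antisymm h hlow
    | succ n ih =>
      rcases hup (K + n + 1) (by omega) with h2 | h2
      · exfalso
        rcases (hσ (K + n) (by omega)).2 _ ih with ⟨h3, -⟩ | ⟨-, y, h3, -⟩
        · have h4 := (le_abs_self _).trans_lt hz.abs_lt
          have h5 := (pow_lt_pow_iff_right₀ (by norm_num : (1 : ℤ) < 2)).1 h4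
          have h6 : (2 : ℤ) ^ c ≤ 2 ^ J := pow_le_pow_right₀ (by norm_num) (by omega)
          have h7 : (2 : ℤ) ^ (p + c) ≤ 2 ^ (p + J) := pow_le_pow_right₀ (by norm_num) (by omega)
          have e1 : (2 : ℤ) ^ (p + J + 2) = 4 * 2 ^ (p + J) := by ring
          have h8 : (2 : ℤ) ^ (J + 1) ≤ 2 ^ (p + J) :=
            pow_le_pow_right₀ (by norm_num) (by omega)
          have e2 : (2 : ℤ) ^ (J + 1) = 2 * 2 ^ J := by ring
          have hJ : (0 : ℤ) < 2 ^ J := by positivity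
          linarith
        · rw [h2] at h3
          exact WithTop.coe_ne_top h3.symm
      · exact le_antisymm h2 (hge (n + 1))

lemma pow_le_of_eq_pow {a : ℕ} (hσ : ∀ k ≥ 1, AddStep p J N (σ k) (σ (k + 1)))
    (h1 : σ 1 = N) (hN : N = 2 ^ a) {k : ℕ} (hk : 1 ≤ k) (hk' : k ≤ 2 ^ (p + 1)) :
    ((k * 2 ^ a : ℤ) : WithTop ℤ) ≤ σ k := by
  induction k, hk using Nat.le_induction with
  | base => rw [h1, hN]; simp
  | succ k hk ih =>
    refine (hσ k hk).le_of_le a (ih (by omega)) (by positivity) (dvd_mul_left _ _) ?_ ?_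
    · rw [pow_add 2 (p + 1)]
      gcongr
      exact_mod_cast hk'
    · rw [hN]; push_cast; linarith

/-- Sums of a number strictly between `2 ^ a` and `2 ^ (a + 1)` exceed those of `2 ^ a` by at
least one ulp. -/
lemma add_pow_le_sum {a : ℕ} (hσ : ∀ k ≥ 1, AddStep p J N (σ k) (σ (k + 1)))
    (h1 : σ 1 = N) (hNF : IsFloatInt p J N) (hN : 2 ^ a < N) {i : ℕ} (hi : i ≤ p)
    {r : ℕ} (hr : r < 2 ^ i) :
    (((2 ^ i + r) * 2 ^ a + 2 ^ (i + a - p) : ℤ) : WithTop ℤ) ≤ σ (2 ^ i + r) := by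
  induction i generalizing r with
  | zero =>
    obtain rfl : r = 0 := by omega
    rw [pow_zero, add_zero, pow_zero, h1]
    refine WithTop.coe_le_coe.2 ?_
    rcases le_or_gt a p with h | h
    · rw [show 0 + a - p = 0 by omega]; push_cast; linarith
    · obtain ⟨c, rfl⟩ := Nat.exists_eq_add_of_lt h
      rw [show 0 + (p + c + 1) - p = c + 1 by omega]
      obtain ⟨d, hd⟩ := (hNF.pow_dvd (c := c + 1) hN.le).sub
        (pow_dvd_pow 2 (by omega : c + 1 ≤ p + c + 1))
      have hc : (0 : ℤ) < 2 ^ (c + 1) := by positivity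
      have h3 : (2 : ℤ) ^ (c + 1) * 0 < 2 ^ (c + 1) * d := by linarith
      have h4 := lt_of_mul_lt_mul_left h3 hc.le
      have h5 : (2 : ℤ) ^ (c + 1) * 1 ≤ 2 ^ (c + 1) * d :=
        mul_le_mul_of_nonneg_left (by omega) hc.le
      push_cast
      linarith
  | succ i IH =>
    have ha : (0 : ℤ) < 2 ^ a := by positivity
    have bound : ∀ c : ℕ, c = i + 1 + a - p → ∀ k : ℕ, k + 1 ≤ 2 ^ (i + 2) →
        (k * 2 ^ a + 2 ^ c : ℤ) ≤ 2 ^ (p + 1 + c) := by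
      intro c hc k hk
      have h2 : (2 : ℤ) ^ c ≤ 2 ^ a := pow_le_pow_right₀ (by norm_num) (by omega)
      have h3 : ((k : ℤ) + 1) * 2 ^ a ≤ 2 ^ (i + 2) * 2 ^ a := by
        gcongr; exact_mod_cast hk
      have h4 : (2 : ℤ) ^ (i + 2 + a) ≤ 2 ^ (p + 1 + c) :=
        pow_le_pow_right₀ (by norm_num) (by omega)
      rw [pow_add 2 (i + 2)] at h4
      linarith
    have hdvd : ∀ c : ℕ, c = i + 1 + a - p → ∀ k : ℤ, (2 : ℤ) ^ c ∣ k * 2 ^ a := fun c hc k =>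
      (pow_dvd_pow 2 (by omega)).mul_left k
    induction r with
    | zero =>
      have hi0 : 1 ≤ 2 ^ i := Nat.one_le_two_pow
      have IH' := IH (by omega) (r := 2 ^ i - 1) (by omega)
      have hs := hσ (2 ^ i + (2 ^ i - 1)) (by omega)
      rw [show 2 ^ i + (2 ^ i - 1) + 1 = 2 ^ (i + 1) + 0 by rw [pow_succ]; omega] at hs
      have hb := bound _ rfl (2 ^ (i + 1)) (by
        rw [pow_succ 2 (i + 1)]
        have : 1 ≤ 2 ^ (i + 1) := Nat.one_le_two_pow
        omega)
      push_cast [hi0] at IH' hb ⊢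
      rw [add_zero]
      have e1 : (2 : ℤ) ^ (i + 1) = 2 * 2 ^ i := by ring
      rcases le_or_gt (i + 1 + a) p with h | h
      · refine hs.le_of_le _ IH' (by positivity)
          (dvd_add (hdvd _ rfl _) dvd_rfl) hb ?_
        rw [show i + 1 + a - p = 0 by omega, show i + a - p = 0 by omega, e1]
        linarith
      · refine hs.add_pow_le _ IH' ?_ (hdvd _ rfl _) hb ?_
        · rw [← pow_add, show p + (i + 1 + a - p) = i + 1 + a by omega]
        · rw [show i + 1 + a - p = (i + a - p) + 1 by omega, pow_succ 2 (i + a - p), e1]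
          linarith
    | succ r ih =>
      have hb := bound _ rfl (2 ^ (i + 1) + (r + 1)) (by rw [pow_succ 2 (i + 1)]; omega)
      push_cast at hb ⊢
      exact (hσ (2 ^ (i + 1) + r) (Nat.one_le_two_pow.trans (Nat.le_add_right _ _))).le_of_le _ (ih (by omega)) (by positivity)
        (dvd_add (hdvd _ rfl _) dvd_rfl) hb (by linarith)

/-- Repeated addition of a positive float becomes constant, at a power of two or at overflow. -/
lemma stable_sum (hp : 2 ≤ p) (hσ : ∀ k ≥ 1, AddStep p J N (σ k) (σ (k + 1)))
    (hF : ∀ k ≥ 1, ∀ y : ℤ, σ k = y → IsFloatInt p J y) (h1 : σ 1 = N) (hN : 0 < N) :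
    (∀ n, σ (3 * 2 ^ p - 1 + n) = ⊤) ∨
      ∃ b : ℕ, IsFloatInt p J (2 ^ b) ∧
        ∀ n, σ (3 * 2 ^ p - 1 + n) = ((2 ^ b : ℤ) : WithTop ℤ) := by
  obtain ⟨a, ha, ha'⟩ : ∃ a : ℕ, 2 ^ a ≤ N ∧ N < 2 ^ (a + 1) := by
    lift N to ℕ using hN.le
    exact ⟨Nat.log 2 N, by exact_mod_cast Nat.pow_log_le_self 2 (by omega),
      by exact_mod_cast Nat.lt_pow_succ_log_self (by norm_num) N⟩
  have hp4 : 2 ^ 2 ≤ 2 ^ p := Nat.pow_le_pow_right (by norm_num) hp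
  have e0 : 2 ^ (p + 1) = 2 * 2 ^ p := by ring
  rcases ha.eq_or_lt with h | h
  · have hlow : ∀ n : ℕ, ((2 ^ (p + (a + 1)) : ℤ) : WithTop ℤ) ≤ σ (2 ^ (p + 1) + n) := by
      intro n
      induction n with
      | zero =>
        have := pow_le_of_eq_pow hσ h1 h.symm Nat.one_le_two_pow le_rfl
        rw [add_zero]
        convert this using 2
        push_cast; ring
      | succ n ih =>
        exact (hσ (2 ^ (p + 1) + n) (by omega)).le_of_le (a + 1) ih (by positivity)
          (pow_dvd_pow 2 (by omega)) (pow_le_pow_right₀ (by norm_num) (by omega)) (by linarith)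
    refine stable_of_le (c := a + 1) (by omega) hσ hF (by omega) hN.le ?_ ?_ ?_
    · rw [← h, pow_succ]; linarith
    · rw [h1, ← h]
      exact WithTop.coe_le_coe.2 (pow_le_pow_right₀ (by norm_num) (by omega))
    · have := hlow (2 ^ p - 1)
      rwa [show 2 ^ (p + 1) + (2 ^ p - 1) = 3 * 2 ^ p - 1 by omega] at this
  · have hlow : ∀ n : ℕ, n ≤ 2 ^ p → ((2 ^ (p + (a + 1)) + n * 2 ^ (a + 1) : ℤ) : WithTop ℤ) ≤
        σ (2 ^ (p + 1) - 1 + n) := by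
      intro n hn
      induction n with
      | zero =>
        have := add_pow_le_sum hσ h1 (hF 1 le_rfl N h1) h le_rfl (r := 2 ^ p - 1) (by omega)
        rw [show 2 ^ p + (2 ^ p - 1) = 2 ^ (p + 1) - 1 + 0 by omega] at this
        convert this using 2
        rw [show p + a - p = a by omega]
        push_cast [show 1 ≤ 2 ^ p by omega]
        ring
      | succ n ih =>
        have := (hσ (2 ^ (p + 1) - 1 + n) (by omega)).add_pow_le
          (w := 2 ^ (p + (a + 1)) + n * 2 ^ (a + 1)) (a + 1) (ih (by omega)) (le_add_of_nonneg_right (by positivity))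
          (dvd_add (pow_dvd_pow 2 (by omega)) (dvd_mul_left _ _)) ?_
          (by rw [pow_succ 2 a]; linarith)
        · rw [← add_assoc (2 ^ (p + 1) - 1) n 1]
          convert this using 2
          push_cast; ring
        · have h2 : ((n : ℤ) + 1) * 2 ^ (a + 1) ≤ 2 ^ p * 2 ^ (a + 1) := by
            gcongr; exact_mod_cast hn
          have e1 : (2 : ℤ) ^ (p + 1 + (a + 1)) = 2 * (2 ^ p * 2 ^ (a + 1)) := by ring
          have e2 : (2 : ℤ) ^ (p + (a + 1)) = 2 ^ p * 2 ^ (a + 1) := by ring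
          linarith
    refine stable_of_le (c := a + 2) (by omega) hσ hF (by omega) hN.le ?_ ?_ ?_
    · rw [pow_succ 2 (a + 1)]; linarith
    · rw [h1]
      exact WithTop.coe_le_coe.2
        (ha'.le.trans (pow_le_pow_right₀ (by norm_num) (by omega)))
    · have := hlow (2 ^ p) le_rfl
      rw [show 2 ^ (p + 1) - 1 + 2 ^ p = 3 * 2 ^ p - 1 by omega] at this
      convert this using 2
      push_cast; ring

end Seq

end FPT

namespace FPT

section Bridge

variable {p q J : ℕ}

/-- The smallest positive subnormal number. -/
noncomputable def ulpMin (p q : ℕ) : ℝ := (2 : ℝ) ^ (emin q - (p : ℤ))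

lemma ulpMin_pos : 0 < ulpMin p q := by unfold ulpMin; positivity

lemma zpow_eq_mul_ulpMin (j : ℕ) : (2 : ℝ) ^ (emin q + j - (p : ℤ)) = 2 ^ j * ulpMin p q := by
  rw [ulpMin, ← zpow_natCast, ← zpow_add₀ (by norm_num)]
  congr 1; ring

lemma mul_ulpMin_mem_Fset (hJ : emin q + J = emax q) {y : ℤ} (h : IsFloatInt p J y) :
    (y : ℝ) * ulpMin p q ∈ Fset p q := by
  obtain ⟨m, j, hm, hj, rfl⟩ := h
  induction j generalizing m with
  | zero => exact ⟨m, emin q, by omega, le_rfl, by omega, .inr rfl, by simp [ulpMin]⟩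
  | succ j ih =>
    rcases lt_or_ge |m| (2 ^ p) with h | h
    · have := ih (m * 2) (by rw [abs_mul, abs_two, pow_succ]; linarith) (by omega)
      rwa [mul_assoc, ← pow_succ'] at this
    · refine ⟨m, emin q + (j + 1 : ℕ), by omega, by omega, by omega, .inl h, ?_⟩
      rw [zpow_eq_mul_ulpMin]; push_cast; ring

lemma mem_Fset_iff (hJ : emin q + J = emax q) {y : ℝ} :
    y ∈ Fset p q ↔ ∃ Y : ℤ, y = Y * ulpMin p q ∧ IsFloatInt p J Y := by
  constructor
  · rintro ⟨m, e, hm, he, he', -, rfl⟩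
    obtain ⟨j, rfl⟩ := Int.le.dest he
    refine ⟨m * 2 ^ j, ?_, m, j, by omega, by omega, rfl⟩
    rw [zpow_eq_mul_ulpMin]; push_cast; ring
  · rintro ⟨Y, rfl, h⟩
    exact mul_ulpMin_mem_Fset hJ h

lemma evenMantissa_iff (hJ : emin q + J = emax q) {Y : ℤ} :
    EvenMantissa p q (Y * ulpMin p q) ↔ IsEvenFloatInt p J Y := by
  constructor
  · rintro ⟨m, e, hm, he, he', hn, h, h2⟩
    obtain ⟨j, rfl⟩ := Int.le.dest he
    refine ⟨m, j, by omega, by omega, hn.imp_right fun h => by omega, ?_, h2⟩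
    rw [zpow_eq_mul_ulpMin, ← mul_assoc] at h
    exact_mod_cast mul_right_cancel₀ ulpMin_pos.ne' h
  · rintro ⟨m, j, hm, hj, hn, rfl, h2⟩
    refine ⟨m, emin q + j, by omega, by omega, by omega, hn.imp_right fun h => by omega, ?_, h2⟩
    rw [zpow_eq_mul_ulpMin]; push_cast; ring

lemma roundsTo_iff (hJ : emin q + J = emax q) {T : ℤ} {y : ℝ} :
    RoundsTo p q (T * ulpMin p q) y ↔ ∃ Y : ℤ, y = Y * ulpMin p q ∧ RoundsToInt p J T Y := by
  have hu := ulpMin_pos (p := p) (q := q)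
  have e : ∀ A : ℤ, |(T : ℝ) * ulpMin p q - A * ulpMin p q| = (|T - A| : ℤ) * ulpMin p q :=
    fun A => by rw [← sub_mul, abs_mul, abs_of_pos hu]; push_cast; rfl
  have key : ∀ Y : ℤ, RoundsTo p q (T * ulpMin p q) (Y * ulpMin p q) ↔ RoundsToInt p J T Y := by
    intro Y
    have inj : ∀ {A B : ℤ}, (A : ℝ) * ulpMin p q = B * ulpMin p q ↔ A = B := fun {A B} => by
      rw [mul_left_inj' hu.ne', Int.cast_inj]
    have hle : ∀ {A B : ℤ}, (A : ℝ) * ulpMin p q ≤ B * ulpMin p q ↔ A ≤ B := fun {A B} => by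
      rw [mul_le_mul_iff_left₀ hu, Int.cast_le]
    have hall : ∀ P : ℝ → Prop,
        (∀ z ∈ Fset p q, P z) ↔ ∀ Z : ℤ, IsFloatInt p J Z → P (Z * ulpMin p q) := by
      intro P
      constructor
      · exact fun h Z hZ => h _ (mul_ulpMin_mem_Fset hJ hZ)
      · intro h z hz
        obtain ⟨Z, rfl, hZ⟩ := (mem_Fset_iff hJ).1 hz
        exact h Z hZ
    have hmem : (Y : ℝ) * ulpMin p q ∈ Fset p q ↔ IsFloatInt p J Y := by
      rw [mem_Fset_iff hJ]
      exact ⟨fun ⟨Z, h, hZ⟩ => inj.1 h ▸ hZ, fun h => ⟨Y, rfl, h⟩⟩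
    rw [RoundsTo, RoundsToInt, hall, hall, hmem, evenMantissa_iff hJ]
    simp only [e, inj, hle]
  constructor
  · intro h
    obtain ⟨Y, rfl, -⟩ := (mem_Fset_iff hJ).1 h.1
    exact ⟨Y, rfl, (key Y).1 h⟩
  · rintro ⟨Y, rfl, h⟩
    exact (key Y).2 h

lemma two_mul_thr (hJ : emin q + J = emax q) :
    2 * thr p q = ((2 ^ (p + J + 2) - 2 ^ J : ℤ) : ℝ) * ulpMin p q := by
  have h1 : (2 : ℝ) ^ emax q = 2 ^ p * (2 ^ J * ulpMin p q) := by
    rw [← zpow_eq_mul_ulpMin, hJ, ← zpow_natCast, ← zpow_add₀ (by norm_num)]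
    congr 1; ring
  have h2 : (2 : ℝ) ^ (emax q - (p : ℤ) - 1) = 2 ^ J * ulpMin p q / 2 := by
    rw [← zpow_eq_mul_ulpMin, hJ, zpow_sub_one₀ (by norm_num)]; rfl
  have h3 : (2 : ℝ) ^ (-(p : ℤ)) * 2 ^ p = 1 := by
    rw [← zpow_natCast, ← zpow_add₀ (by norm_num)]; simp
  rw [thr, Omega, h1, h2]
  push_cast
  linear_combination (-2 * (2 ^ J * ulpMin p q)) * h3

/-- The extended float with sign `ε` and magnitude `A` times the smallest positive subnormal. -/
noncomputable def ofWithTop (p q : ℕ) (ε : ℤ) : WithTop ℤ → EF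
  | none => if ε = 1 then .pinf else .ninf
  | some s => .fin ((ε * s : ℤ) * ulpMin p q)

lemma ofWithTop_top {ε : ℤ} : ofWithTop p q ε ⊤ = if ε = 1 then .pinf else .ninf := rfl

lemma ofWithTop_coe {ε s : ℤ} : ofWithTop p q ε s = .fin ((ε * s : ℤ) * ulpMin p q) := rfl

lemma ofWithTop_injective {ε : ℤ} (hε : ε ≠ 0) : Function.Injective (ofWithTop p q ε) := by
  intro A B h
  have hu := ulpMin_pos (p := p) (q := q)
  cases A <;> cases B <;> simp only [ofWithTop_top, ofWithTop_coe] at h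
  · rfl
  · split_ifs at h
  · split_ifs at h
  · injection h with h
    have h' := Int.cast_injective (mul_right_cancel₀ hu.ne' h)
    rw [mul_left_cancel₀ hε h']

lemma rnd_mul_ulpMin (hp : 1 ≤ p) (hJ : emin q + J = emax q) {ε t : ℤ} (hε : ε = 1 ∨ ε = -1)
    (ht : 0 ≤ t) : ∃ B : WithTop ℤ, rnd p q ((ε * t : ℤ) * ulpMin p q) = ofWithTop p q ε B ∧
      (((2 : ℤ) ^ (p + J + 2) - 2 ^ J ≤ 2 * t ∧ B = ⊤) ∨
        (2 * t < (2 : ℤ) ^ (p + J + 2) - 2 ^ J ∧ ∃ y : ℤ, B = y ∧ RoundsToInt p J t y)) := by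
  have hu := ulpMin_pos (p := p) (q := q)
  have hthr := two_mul_thr (p := p) hJ
  have hH : (0 : ℤ) < 2 ^ (p + J + 2) - 2 ^ J :=
    sub_pos.2 (pow_lt_pow_right₀ (by norm_num) (by omega))
  have hex := exists_roundsToInt (J := J) hp ht
  generalize (2 : ℤ) ^ (p + J + 2) - 2 ^ J = H at *
  have h1 : ∀ s : ℤ, thr p q ≤ s * ulpMin p q ↔ H ≤ 2 * s := fun s => by
    rw [← mul_le_mul_iff_right₀ (two_pos (α := ℝ)), hthr, ← mul_assoc, mul_le_mul_iff_left₀ hu]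
    exact_mod_cast Iff.rfl
  have h2 : ∀ s : ℤ, s * ulpMin p q ≤ -thr p q ↔ H ≤ 2 * -s := fun s => by
    rw [← h1, le_neg]; push_cast; rw [neg_mul]
  have hround : 2 * t < H → ∃ y : ℤ, RoundsToInt p J t y ∧
      Classical.epsilon (RoundsTo p q ((ε * t : ℤ) * ulpMin p q)) =
        (ε * y : ℤ) * ulpMin p q := by
    intro hlt
    have hneg : ∀ {t y : ℤ}, RoundsToInt p J t y → RoundsToInt p J (ε * t) (ε * y) := by
      intro t y h
      rcases hε with rfl | rfl
      · simpa using h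
      · simpa using h.neg
    have hεε : ε * ε = 1 := by rcases hε with rfl | rfl <;> norm_num
    obtain ⟨y₀, hy₀⟩ := hex hlt
    obtain ⟨Y, hY, hYr⟩ := (roundsTo_iff hJ).1
      (Classical.epsilon_spec (p := RoundsTo p q ((ε * t : ℤ) * ulpMin p q))
        ⟨_, (roundsTo_iff hJ).2 ⟨_, rfl, hneg hy₀⟩⟩)
    have h3 := hneg hYr
    rw [← mul_assoc, hεε, one_mul] at h3
    exact ⟨ε * Y, h3, by rw [hY, ← mul_assoc, hεε, one_mul]⟩
  rcases lt_or_ge (2 * t) H with hlt | hle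
  · obtain ⟨y, hy, hey⟩ := hround hlt
    refine ⟨y, ?_, .inr ⟨hlt, y, rfl, hy⟩⟩
    rw [rnd, if_neg, if_neg, hey, ofWithTop_coe]
    · rw [h2]; rcases hε with rfl | rfl <;> linarith
    · rw [h1]; rcases hε with rfl | rfl <;> linarith
  · refine ⟨⊤, ?_, .inl ⟨hle, rfl⟩⟩
    rcases hε with rfl | rfl
    · rw [rnd, if_pos ((h1 _).2 (by linarith)), ofWithTop_top, if_pos rfl]
    · rw [rnd, if_neg, if_pos ((h2 _).2 (by linarith)), ofWithTop_top, if_neg (by norm_num)]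
      rw [h1]; linarith

lemma fsuml_replicate_succ (x : EF) {k : ℕ} (hk : 1 ≤ k) :
    fsuml p q (List.replicate (k + 1) x) = fadd p q (fsuml p q (List.replicate k x)) x := by
  obtain ⟨k, rfl⟩ := Nat.exists_eq_add_of_le' hk
  change (List.replicate (k + 1) x).foldl (fadd p q) x =
    fadd p q ((List.replicate k x).foldl (fadd p q) x) x
  rw [List.replicate_succ', List.foldl_append]
  rfl

lemma fsuml_replicate_of_fadd_self {x : EF} (hx : fadd p q x x = x) {k : ℕ} (hk : 1 ≤ k) :
    fsuml p q (List.replicate k x) = x := by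
  induction k, hk using Nat.le_induction with
  | base => rfl
  | succ k hk ih => rw [fsuml_replicate_succ x hk, ih, hx]

lemma rnd_zero (hp : 1 ≤ p) (hJ : emin q + J = emax q) : rnd p q 0 = .fin 0 := by
  have hH : (0 : ℤ) < 2 ^ (p + J + 2) - 2 ^ J :=
    sub_pos.2 (pow_lt_pow_right₀ (by norm_num) (by omega))
  obtain ⟨B, hB, ⟨h, -⟩ | ⟨-, y, rfl, hy⟩⟩ :=
    rnd_mul_ulpMin (ε := 1) (t := 0) hp hJ (.inl rfl) le_rfl
  · linarith
  · have := hy.2.1 0 isFloatInt_zero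
    rw [sub_self, abs_zero, zero_sub, abs_neg] at this
    obtain rfl := abs_eq_zero.1 (le_antisymm this (abs_nonneg y))
    rw [ofWithTop_coe] at hB
    simpa using hB

/-- Repeated floating-point sums of a nonzero float follow an integer model. -/
lemma exists_addStep_seq (hp : 1 ≤ p) (hJ : emin q + J = emax q) {ε N : ℤ}
    (hε : ε = 1 ∨ ε = -1) (hN : 0 < N) (hNF : IsFloatInt p J N) :
    ∃ σ : ℕ → WithTop ℤ,
      (∀ k ≥ 1, fsuml p q (List.replicate k (.fin ((ε * N : ℤ) * ulpMin p q))) =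
        ofWithTop p q ε (σ k)) ∧
      σ 1 = N ∧ (∀ k ≥ 1, AddStep p J N (σ k) (σ (k + 1))) ∧
      ∀ k ≥ 1, ∀ y : ℤ, σ k = y → IsFloatInt p J y := by
  set x : EF := .fin ((ε * N : ℤ) * ulpMin p q) with hx
  have hε0 : ε ≠ 0 := by rcases hε with rfl | rfl <;> norm_num
  have step : ∀ A : WithTop ℤ, 0 ≤ A → ∃ B : WithTop ℤ, 0 ≤ B ∧
      (∀ y : ℤ, B = y → IsFloatInt p J y) ∧
      fadd p q (ofWithTop p q ε A) x = ofWithTop p q ε B ∧ AddStep p J N A B := by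
    intro A hA
    cases A with
    | top =>
      refine ⟨⊤, le_top, fun y hy => absurd hy.symm WithTop.coe_ne_top, ?_, fun _ => rfl,
        fun s hs => absurd hs.symm WithTop.coe_ne_top⟩
      rw [ofWithTop_top]
      split_ifs <;> rfl
    | coe s =>
      have hs : 0 ≤ s := by exact_mod_cast hA
      obtain ⟨B, hB, hc⟩ := rnd_mul_ulpMin hp hJ hε (add_nonneg hs hN.le)
      have hstep : AddStep p J N s B := by
        refine ⟨fun h => absurd h WithTop.coe_ne_top, fun s' hs' => ?_⟩
        obtain rfl := WithTop.coe_injective hs'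
        exact hc
      refine ⟨B, ?_, ?_, ?_, hstep⟩
      · exact hstep.le_of_le (z := 0) 0 hA le_rfl (dvd_zero _) (by positivity) (by linarith)
      · rintro y rfl
        rcases hc with ⟨-, h⟩ | ⟨-, y', h, hy'⟩
        · exact absurd h WithTop.coe_ne_top
        · rw [WithTop.coe_injective h]; exact hy'.1
      · rw [← hB, ofWithTop_coe, hx, fadd, ← add_mul, mul_add]
        push_cast; rfl
  have main : ∀ k, 1 ≤ k → ∃ A : WithTop ℤ, 0 ≤ A ∧
      (∀ y : ℤ, A = y → IsFloatInt p J y) ∧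
      fsuml p q (List.replicate k x) = ofWithTop p q ε A := by
    intro k hk
    induction k, hk using Nat.le_induction with
    | base =>
      refine ⟨N, by exact_mod_cast hN.le, fun y hy => ?_, rfl⟩
      rwa [← WithTop.coe_injective hy]
    | succ k hk ih =>
      obtain ⟨A, hA, -, hAk⟩ := ih
      obtain ⟨B, hB, hBF, h, -⟩ := step A hA
      exact ⟨B, hB, hBF, by rw [fsuml_replicate_succ x hk, hAk, h]⟩
  choose! σ h0 hF hσ using main
  refine ⟨σ, hσ, (ofWithTop_injective hε0 ((hσ 1 le_rfl).symm.trans rfl)),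
    fun k hk => ?_, hF⟩
  obtain ⟨B, -, -, h, hB⟩ := step (σ k) (h0 k hk)
  rw [← hσ k hk, ← fsuml_replicate_succ x hk, hσ (k + 1) (by omega)] at h
  rwa [ofWithTop_injective hε0 h]

end Bridge

end FPT

/-- Lemma `same-sum0`. Repeated floating-point addition of the same
number saturates after `3·2^p − 1` terms, and the saturated value is `0`, `±∞`, NaN, or a
(signed) power of two. -/
theorem stmt10 (p q : ℕ) (hp : 2 ≤ p) (hpq : (p : ℤ) ≤ 2 ^ (q - 1) - 3)
    (x : FPT.EF) (hx : x.Valid p q) :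
    (∀ n m : ℕ,
      FPT.fsuml p q (List.replicate (3 * 2 ^ p - 1 + n) x) =
        FPT.fsuml p q (List.replicate (3 * 2 ^ p - 1 + m) x)) ∧
    (FPT.fsuml p q (List.replicate (3 * 2 ^ p - 1) x) = .fin 0 ∨
      FPT.fsuml p q (List.replicate (3 * 2 ^ p - 1) x) = .pinf ∨
      FPT.fsuml p q (List.replicate (3 * 2 ^ p - 1) x) = .ninf ∨
      FPT.fsuml p q (List.replicate (3 * 2 ^ p - 1) x) = .nan ∨
      ∃ e : ℤ, ((2 : ℝ) ^ e ∈ FPT.Fset p q ∧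
        (FPT.fsuml p q (List.replicate (3 * 2 ^ p - 1) x) = .fin ((2 : ℝ) ^ e) ∨
         FPT.fsuml p q (List.replicate (3 * 2 ^ p - 1) x) = .fin (-((2 : ℝ) ^ e))))) := by
  have hp1 : 1 ≤ p := by omega
  obtain ⟨J, hJ⟩ : ∃ J : ℕ, FPT.emin q + J = FPT.emax q :=
    Int.le.dest (by unfold FPT.emin FPT.emax; omega)
  have hK1 : ∀ n, 1 ≤ 3 * 2 ^ p - 1 + n := fun n => by
    have := Nat.one_le_two_pow (n := p)
    omega
  suffices h : ∃ E : FPT.EF,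
      (∀ n, FPT.fsuml p q (List.replicate (3 * 2 ^ p - 1 + n) x) = E) ∧
      (E = .fin 0 ∨ E = .pinf ∨ E = .ninf ∨ E = .nan ∨
        ∃ e : ℤ, ((2 : ℝ) ^ e ∈ FPT.Fset p q ∧
          (E = .fin ((2 : ℝ) ^ e) ∨ E = .fin (-((2 : ℝ) ^ e))))) by
    obtain ⟨E, hE, h⟩ := h
    refine ⟨fun n m => by rw [hE, hE], ?_⟩
    have h0 := hE 0
    rw [add_zero] at h0
    rwa [h0]
  have hself : FPT.fadd p q x x = x → ∀ n,
      FPT.fsuml p q (List.replicate (3 * 2 ^ p - 1 + n) x) = x := fun h n =>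
    FPT.fsuml_replicate_of_fadd_self h (hK1 n)
  cases x with
  | pinf => exact ⟨_, hself rfl, by simp⟩
  | ninf => exact ⟨_, hself rfl, by simp⟩
  | nan => exact ⟨_, hself rfl, by simp⟩
  | fin r =>
    obtain ⟨Y, rfl, hY⟩ := (FPT.mem_Fset_iff hJ).1 hx
    rcases eq_or_ne Y 0 with rfl | hY0
    · refine ⟨_, hself ?_, .inl (by simp)⟩
      simp only [FPT.fadd, Int.cast_zero, zero_mul, add_zero]
      exact FPT.rnd_zero hp1 hJ
    obtain ⟨ε, N, hε, hN, hNF, rfl⟩ : ∃ ε N : ℤ, (ε = 1 ∨ ε = -1) ∧ 0 < N ∧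
        FPT.IsFloatInt p J N ∧ Y = ε * N := by
      rcases hY0.lt_or_gt with h | h
      · exact ⟨-1, -Y, .inr rfl, by omega, hY.neg, by ring⟩
      · exact ⟨1, Y, .inl rfl, h, hY, by ring⟩
    obtain ⟨σ, hσ, h1, hstep, hF⟩ := FPT.exists_addStep_seq hp1 hJ hε hN hNF
    rcases FPT.stable_sum hp hstep hF h1 hN with h | ⟨b, hb, h⟩
    · refine ⟨FPT.ofWithTop p q ε ⊤, fun n => by rw [hσ _ (hK1 n), h n], ?_⟩
      rw [FPT.ofWithTop_top]
      split_ifs <;> simp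
    · refine ⟨FPT.ofWithTop p q ε ((2 ^ b : ℤ) : WithTop ℤ),
        fun n => by rw [hσ _ (hK1 n), h n], ?_⟩
      have hpow : (2 : ℝ) ^ (FPT.emin q + b - (p : ℤ)) = ((2 ^ b : ℤ) : ℝ) * FPT.ulpMin p q := by
        rw [FPT.zpow_eq_mul_ulpMin]; push_cast; rfl
      refine .inr (.inr (.inr (.inr ⟨FPT.emin q + b - (p : ℤ), ?_, ?_⟩)))
      · rw [hpow]; exact FPT.mul_ulpMin_mem_Fset hJ hb
      · rw [hpow, FPT.ofWithTop_coe]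
        rcases hε with rfl | rfl
        · left; rw [one_mul]
        · right; push_cast; rw [neg_one_mul, neg_mul]
end
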